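/- Let ℓ ∈ ℕ. Suppose S ⊆ ℤ has the property that for every m ∈ ℕ there exist integers c_m and N_m, with N_m → ∞ as m → ∞, such that c_m + mn ∈ S for every integer 1 ≤ n ≤ N_m. Then every Λ ⊆ ℤ with d̄(Λ) > 0 contains an arithmetic progression {r, r+s, r+2s, …, r+ℓs} for some r ∈ ℤ and some nonzero s ∈ S. -/

import Mathlib

open Filter MeasureTheory

/-- The upper density of a set of integers. -/
noncomputable def upperDensity (Λ : Set ℤ) : ℝ :=
  Filter.limsup
    (fun N : ℕ => (Nat.card ↥(Λ ∩ Set.Icc (-(N : ℤ)) (N : ℤ)) : ℝ) / (2 * N + 1))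
    Filter.atTop


namespace SZ
open Topology

def Bdd {Y : Type} (f : Y → ℝ) : Prop := ∃ C, ∀ x, |f x| ≤ C

section bdd
variable {Y Z P : Type} {f g : Y → ℝ}
theorem Bdd.of1 {f : Y → ℝ} (h : ∀ x, |f x| ≤ 1) : Bdd f := ⟨1, h⟩
theorem Bdd.pos (hf : Bdd f) : ∃ C, 0 ≤ C ∧ ∀ x, |f x| ≤ C := by
  obtain ⟨C, h⟩ := hf
  exact ⟨max C 0, le_max_right _ _, fun x => (h x).trans (le_max_left _ _)⟩
@[simp] theorem Bdd.const (c : ℝ) : Bdd (fun _ : Y => c) := ⟨|c|, fun _ => le_rfl⟩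
@[simp] theorem Bdd.add (hf : Bdd f) (hg : Bdd g) : Bdd (fun x => f x + g x) := by
  obtain ⟨C, h⟩ := hf; obtain ⟨D, k⟩ := hg
  exact ⟨C + D, fun x => (abs_add_le _ _).trans (add_le_add (h x) (k x))⟩
@[simp] theorem Bdd.mul (hf : Bdd f) (hg : Bdd g) : Bdd (fun x => f x * g x) := by
  obtain ⟨C, hC, h⟩ := hf.pos; obtain ⟨D, k⟩ := hg
  exact ⟨C * D, fun x => by rw [abs_mul]; exact mul_le_mul (h x) (k x) (abs_nonneg _) hC⟩
@[simp] theorem Bdd.neg (hf : Bdd f) : Bdd (fun x => - f x) := by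
  obtain ⟨C, h⟩ := hf; exact ⟨C, fun x => by rw [abs_neg]; exact h x⟩
@[simp] theorem Bdd.sub (hf : Bdd f) (hg : Bdd g) : Bdd (fun x => f x - g x) := by
  simpa [sub_eq_add_neg] using hf.add hg.neg
@[simp] theorem Bdd.pow (hf : Bdd f) (n : ℕ) : Bdd (fun x => f x ^ n) := by
  obtain ⟨C, h⟩ := hf
  exact ⟨C ^ n, fun x => by rw [abs_pow]; exact pow_le_pow_left₀ (abs_nonneg _) (h x) n⟩
theorem Bdd.comp (hf : Bdd f) (e : Z → Y) : Bdd (fun x => f (e x)) := by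
  obtain ⟨C, h⟩ := hf; exact ⟨C, fun x => h _⟩
@[simp] theorem Bdd.sum {I : Type} (s : Finset I) {f : I → Y → ℝ} (h : ∀ i ∈ s, Bdd (f i)) :
    Bdd (fun x => ∑ i ∈ s, f i x) := by
  classical
  induction s using Finset.induction_on with
  | empty => simp
  | insert a s ha ih =>
    simp only [Finset.sum_insert ha]
    exact (h a (by simp)).add (ih fun i hi => h i (by simp [hi]))
@[simp] theorem Bdd.prod {I : Type} (s : Finset I) {f : I → Y → ℝ} (h : ∀ i ∈ s, Bdd (f i)) :
    Bdd (fun x => ∏ i ∈ s, f i x) := by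
  classical
  induction s using Finset.induction_on with
  | empty => simp
  | insert a s ha ih =>
    simp only [Finset.prod_insert ha]
    exact (h a (by simp)).mul (ih fun i hi => h i (by simp [hi]))
end bdd

structure Mean (Y : Type) where
  f : (Y → ℝ) → ℝ
  add' : ∀ a b, Bdd a → Bdd b → f (fun x => a x + b x) = f a + f b
  smul' : ∀ (c : ℝ) a, Bdd a → f (fun x => c * a x) = c * f a
  nonneg' : ∀ a, Bdd a → (∀ x, 0 ≤ a x) → 0 ≤ f a
  one' : f (fun _ => 1) = 1

instance {Y : Type} : CoeFun (Mean Y) (fun _ => (Y → ℝ) → ℝ) := ⟨Mean.f⟩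

/-- bounded linear functional on bounded functions -/
structure Lin {P : Type} (M : (P → ℝ) → ℝ) : Prop where
  add : ∀ a b, Bdd a → Bdd b → M (fun x => a x + b x) = M a + M b
  smul : ∀ (c : ℝ) a, Bdd a → M (fun x => c * a x) = c * M a

theorem Lin.sub {P : Type} {M : (P → ℝ) → ℝ} (h : Lin M) {a b : P → ℝ} (ha : Bdd a) (hb : Bdd b) :
    M (fun x => a x - b x) = M a - M b := by
  have h1 := h.add a (fun x => (-1) * b x) ha (by simp [hb])
  rw [h.smul _ _ hb] at h1
  have : (fun x => a x - b x) = fun x => a x + (-1) * b x := by ext; ring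
  rw [this, h1]; ring

namespace Mean
variable {Y P : Type} (μ : Mean Y) {a b : Y → ℝ}
theorem lin : Lin μ.f := ⟨μ.add', μ.smul'⟩
theorem add (ha : Bdd a) (hb : Bdd b) : μ (fun x => a x + b x) = μ a + μ b := μ.add' a b ha hb
theorem smul (c : ℝ) (ha : Bdd a) : μ (fun x => c * a x) = c * μ a := μ.smul' c a ha
theorem sub (ha : Bdd a) (hb : Bdd b) : μ (fun x => a x - b x) = μ a - μ b := μ.lin.sub ha hb
theorem nonneg (ha : Bdd a) (h : ∀ x, 0 ≤ a x) : 0 ≤ μ a := μ.nonneg' a ha h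
@[simp] theorem const (c : ℝ) : μ (fun _ => c) = c := by
  have := μ.smul c (a := fun _ => 1) (by simp)
  simpa [μ.one'] using this
theorem mono (ha : Bdd a) (hb : Bdd b) (h : ∀ x, a x ≤ b x) : μ a ≤ μ b := by
  have := μ.nonneg (hb.sub ha) (fun x => sub_nonneg.2 (h x))
  rw [μ.sub hb ha] at this; linarith
theorem le_of (ha : Bdd a) {c : ℝ} (h : ∀ x, a x ≤ c) : μ a ≤ c := by
  simpa using μ.mono ha (Bdd.const c) h
theorem ge_of (ha : Bdd a) {c : ℝ} (h : ∀ x, c ≤ a x) : c ≤ μ a := by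
  simpa using μ.mono (Bdd.const c) ha h
theorem absle {c : ℝ} (h : ∀ x, |a x| ≤ c) : |μ a| ≤ c :=
  abs_le.2 ⟨μ.ge_of ⟨c, h⟩ fun x => (abs_le.1 (h x)).1,
    μ.le_of ⟨c, h⟩ fun x => (abs_le.1 (h x)).2⟩
theorem sum {I : Type} (s : Finset I) {f : I → Y → ℝ} (h : ∀ i ∈ s, Bdd (f i)) :
    μ (fun x => ∑ i ∈ s, f i x) = ∑ i ∈ s, μ (f i) := by
  classical
  induction s using Finset.induction_on with
  | empty => simp
  | insert a s ha ih =>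
    simp only [Finset.sum_insert ha]
    rw [μ.add (h a (by simp)) (Bdd.sum s fun i hi => h i (by simp [hi])),
      ih fun i hi => h i (by simp [hi])]
theorem close {c : ℝ} (ha : Bdd a) (hb : Bdd b) (h : ∀ x, |a x - b x| ≤ c) : |μ a - μ b| ≤ c := by
  rw [← μ.sub ha hb]; exact μ.absle h

@[simp] theorem bdd (M : Mean P) {Φ : Y → P → ℝ} (h : Bdd (fun q : Y × P => Φ q.1 q.2)) :
    Bdd (fun x => M (Φ x)) := by
  obtain ⟨C, h⟩ := h
  exact ⟨C, fun x => M.absle fun p => h (x, p)⟩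

/-- product: M_p (μ_x Φ(x,p)) -/
def prod (μ : Mean Y) (M : Mean P) : Mean (Y × P) where
  f Φ := M fun p => μ fun x => Φ (x, p)
  add' a b ha hb := by
    rw [← M.add]
    · congr 1; ext p; exact μ.add (ha.comp _) (hb.comp _)
    · exact bdd _ (ha.comp fun q : P × Y => (q.2, q.1))
    · exact bdd _ (hb.comp fun q : P × Y => (q.2, q.1))
  smul' c a ha := by
    rw [← M.smul]
    · congr 1; ext p; exact μ.smul c (ha.comp _)
    · exact bdd _ (ha.comp fun q : P × Y => (q.2, q.1))
  nonneg' a ha h := M.nonneg (bdd _ (ha.comp fun q : P × Y => (q.2, q.1)))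
      fun p => μ.nonneg (ha.comp _) fun x => h _
  one' := by simp
theorem prod_apply (M : Mean P) (Φ : Y × P → ℝ) :
  (μ.prod M) Φ = M fun p => μ fun x => Φ (x, p) := rfl

noncomputable def nrm (g : Y → ℝ) : ℝ := √(μ fun x => g x * g x)
theorem nrm_nonneg (g : Y → ℝ) : 0 ≤ μ.nrm g := Real.sqrt_nonneg _
theorem sq_nonneg (ha : Bdd a) : 0 ≤ μ fun x => a x * a x :=
  μ.nonneg (by simp [ha]) fun x => mul_self_nonneg _
theorem nrm_sq (ha : Bdd a) : μ.nrm a ^ 2 = μ fun x => a x * a x :=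
  Real.sq_sqrt (μ.sq_nonneg ha)
theorem nrm_le (ha : ∀ x, |a x| ≤ 1) : μ.nrm a ≤ 1 := by
  have hb : Bdd a := ⟨1, ha⟩
  refine Real.sqrt_le_one.2 ?_
  exact μ.le_of (by simp [hb]) fun x => by
    have := ha x; rw [← abs_mul_abs_self]; nlinarith [abs_nonneg (a x)]
theorem nrm_sq_expand (ha : Bdd a) (hb : Bdd b) (s : ℝ) :
    (μ fun x => (a x + s * b x) * (a x + s * b x)) =
      (μ fun x => a x * a x) + 2 * s * (μ fun x => a x * b x) + s ^ 2 * (μ fun x => b x * b x) := by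
  have : (fun x => (a x + s * b x) * (a x + s * b x)) =
      fun x => (a x * a x + (2 * s) * (a x * b x)) + s ^ 2 * (b x * b x) := by ext; ring
  have h1 : Bdd fun x => a x * a x := ha.mul ha
  have h2 : Bdd fun x => a x * b x := ha.mul hb
  have h3 : Bdd fun x => b x * b x := hb.mul hb
  have h4 : Bdd fun x => (2 * s) * (a x * b x) := (Bdd.const _).mul h2
  have h5 : Bdd fun x => s ^ 2 * (b x * b x) := (Bdd.const _).mul h3
  rw [this, μ.add (h1.add h4) h5, μ.add h1 h4, μ.smul _ h2, μ.smul _ h3]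
theorem cs_sq (ha : Bdd a) (hb : Bdd b) :
    (μ fun x => a x * b x) ^ 2 ≤ (μ fun x => a x * a x) * (μ fun x => b x * b x) := by
  have h : ∀ s : ℝ, 0 ≤ (μ fun x => b x * b x) * (s * s) + (2 * (μ fun x => a x * b x)) * s
      + μ fun x => a x * a x := fun s => by
    have h1 := μ.sq_nonneg (a := fun x => a x + s * b x) (by simp [ha, hb])
    rw [μ.nrm_sq_expand ha hb] at h1; linarith
  have := discrim_le_zero h
  rw [discrim] at this; nlinarith
theorem cs (ha : Bdd a) (hb : Bdd b) : |μ fun x => a x * b x| ≤ μ.nrm a * μ.nrm b := by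
  refine abs_le_of_sq_le_sq ?_ (mul_nonneg (μ.nrm_nonneg _) (μ.nrm_nonneg _))
  rw [mul_pow, μ.nrm_sq ha, μ.nrm_sq hb]; exact μ.cs_sq ha hb
end Mean

section RA
variable {Y P : Type} (μ : Mean Y)

theorem RA {L : (Y → ℝ) → ℝ} (hL : Lin L) (C : ℝ) (hC : 0 ≤ C)
    (hb : ∀ g, Bdd g → |L g| ≤ C * μ.nrm g) (δ : ℝ) (hδ : 0 < δ) :
    ∃ y, Bdd y ∧ μ.nrm y ≤ C + δ ∧ ∀ g, Bdd g → |L g - μ fun x => y x * g x| ≤ δ * μ.nrm g := by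
  let J : {g : Y → ℝ // Bdd g} → ℝ := fun g => (μ fun x => g.1 x * g.1 x) - 2 * L g.1
  have hJ : BddBelow (Set.range J) := ⟨-C ^ 2, by
    rintro _ ⟨⟨g, hg⟩, rfl⟩
    have h1 := (abs_le.1 (hb g hg)).2
    show -C ^ 2 ≤ (μ fun x => g x * g x) - 2 * L g
    rw [← μ.nrm_sq hg]
    nlinarith [sq_nonneg (C - μ.nrm g)]⟩
  have : Nonempty {g : Y → ℝ // Bdd g} := ⟨⟨fun _ => 0, by simp⟩⟩
  obtain ⟨⟨y, hy⟩, hlt⟩ := exists_lt_of_ciInf_lt (show iInf J < iInf J + δ ^ 2 by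
    have := pow_pos hδ 2; linarith)
  have key : ∀ g, Bdd g → |L g - μ fun x => y x * g x| ≤ δ * μ.nrm g := by
    intro g hg
    have h : ∀ s : ℝ, 0 ≤ (μ fun x => g x * g x) * (s * s) +
        (2 * ((μ fun x => y x * g x) - L g)) * s + δ ^ 2 := fun s => by
      have hb' : Bdd (fun x => y x + s * g x) := by simp [hy, hg]
      have h1 := ciInf_le hJ ⟨_, hb'⟩
      have h2 : J ⟨_, hb'⟩ = (μ fun x => (y x + s * g x) * (y x + s * g x))
        - 2 * L (fun x => y x + s * g x) := rfl
      rw [μ.nrm_sq_expand hy hg, hL.add _ _ hy (by simp [hg]), hL.smul _ _ hg] at h2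
      have h3 : J ⟨y, hy⟩ = (μ fun x => y x * y x) - 2 * L y := rfl
      nlinarith
    have := discrim_le_zero h
    rw [discrim] at this
    refine abs_le_of_sq_le_sq ?_ (mul_nonneg hδ.le (μ.nrm_nonneg _))
    rw [mul_pow, μ.nrm_sq hg]; nlinarith
  refine ⟨y, hy, ?_, key⟩
  have h1 := key y hy
  have h2 := hb y hy
  rw [← μ.nrm_sq hy] at h1
  have h0 := μ.nrm_nonneg y
  by_contra! hlt'
  have := (abs_le.1 h1).1
  have := (abs_le.1 h2).2
  nlinarith

theorem le_of_cont {a : ℝ} {p : ℝ → ℝ} (hp : Continuous p) (h : ∀ δ, 0 < δ → a ≤ p δ) : a ≤ p 0 := by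
  have : Tendsto p (𝓝[>] 0) (𝓝 (p 0)) := (hp.tendsto 0).mono_left nhdsWithin_le_nhds
  exact ge_of_tendsto this (eventually_nhdsWithin_of_forall fun δ hδ => h δ hδ)

structure BLin (M : (P → ℝ) → ℝ) (B : ℝ) : Prop extends Lin M where
  bd : ∀ a c, (∀ p, |a p| ≤ c) → |M a| ≤ B * c

theorem Mean.blin (M : Mean P) : BLin M.f 1 :=
  ⟨M.lin, fun a c h => by simpa using M.absle h⟩

theorem BLin.sub {M M' : (P → ℝ) → ℝ} {B B' : ℝ} (h : BLin M B) (h' : BLin M' B') :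
    BLin (fun a => M a - M' a) (B + B') where
  add a b ha hb := by simp only [h.add a b ha hb, h'.add a b ha hb]; ring
  smul c a ha := by simp only [h.smul c a ha, h'.smul c a ha]; ring
  bd a c hc := by
    have h1 := abs_le.1 (h.bd a c hc)
    have h2 := abs_le.1 (h'.bd a c hc)
    rw [abs_le]; constructor <;> nlinarith

theorem pairLin {M : (P → ℝ) → ℝ} {B : ℝ} (hM : BLin M B) {Ξ : P → Y → ℝ}
    (hΞ : ∀ p x, |Ξ p x| ≤ 1) :
    Lin (fun g : Y → ℝ => M fun p => μ fun x => g x * Ξ p x) ∧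
    ∀ g, Bdd g → |M fun p => μ fun x => g x * Ξ p x| ≤ B * μ.nrm g := by
  have hb : ∀ p, Bdd (Ξ p) := fun p => ⟨1, hΞ p⟩
  have key : ∀ g, Bdd g → ∀ p, |μ fun x => g x * Ξ p x| ≤ μ.nrm g := fun g hg p =>
    (μ.cs hg (hb p)).trans (mul_le_of_le_one_right (μ.nrm_nonneg _) (μ.nrm_le (hΞ p)))
  refine ⟨⟨fun a b ha hb' => ?_, fun c a ha => ?_⟩, fun g hg => hM.bd _ _ (key g hg)⟩
  · rw [← hM.add _ _ ⟨_, key a ha⟩ ⟨_, key b hb'⟩]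
    congr 1; ext p
    rw [← μ.add (by simp [ha, hb p]) (by simp [hb', hb p])]
    congr 1; ext x; ring
  · rw [← hM.smul _ _ ⟨_, key a ha⟩]
    congr 1; ext p
    rw [← μ.smul _ (by simp [ha, hb p])]
    congr 1; ext x; ring

/-- general square-function inequality -/
theorem RR {M : (P → ℝ) → ℝ} {B : ℝ} (hM : BLin M B) (hB : 0 ≤ B) {Ξ : P → Y → ℝ}
    (hΞ : ∀ p x, |Ξ p x| ≤ 1) {g : Y → ℝ} (hg : Bdd g) :
    (M fun p => μ fun x => g x * Ξ p x) ^ 2 ≤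
      (M fun q => M fun p => μ fun x => Ξ q x * Ξ p x) * μ fun x => g x * g x := by
  obtain ⟨hL, hLb⟩ := pairLin μ hM hΞ
  have hb : ∀ p, Bdd (Ξ p) := fun p => ⟨1, hΞ p⟩
  set L := fun g : Y → ℝ => M fun p => μ fun x => g x * Ξ p x with hLdef
  set η := M fun q => L (Ξ q)
  show (L g) ^ 2 ≤ η * _
  rw [← μ.nrm_sq hg]
  have h0 := μ.nrm_nonneg g
  have := le_of_cont (a := (L g) ^ 2)
    (p := fun δ => (η + B * δ + δ * (B + δ) + 2 * (B + δ) * δ + δ ^ 2) * μ.nrm g ^ 2)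
    (by fun_prop) (fun δ hδ => by
      obtain ⟨y, hy, hyn, hyk⟩ := RA μ hL B hB hLb δ hδ
      have hyn0 := μ.nrm_nonneg y
      have hq : ∀ q, |(μ fun x => y x * Ξ q x) - L (Ξ q)| ≤ δ := fun q => by
        rw [abs_sub_comm]
        exact (hyk _ (hb q)).trans (mul_le_of_le_one_right hδ.le (μ.nrm_le (hΞ q)))
      have hbL : Bdd fun q => L (Ξ q) := ⟨B, fun q => (hLb _ (hb q)).trans
        (mul_le_of_le_one_right hB (μ.nrm_le (hΞ q)))⟩
      have hby : Bdd fun q => μ fun x => y x * Ξ q x := by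
        have := hbL.add (f := fun q => L (Ξ q)) (g := fun q => (μ fun x => y x * Ξ q x) - L (Ξ q)) ⟨δ, hq⟩
        simpa using this
      have h1 := hM.bd _ _ hq
      rw [hM.toLin.sub hby hbL] at h1
      have h2 := hyk y hy
      rw [← μ.nrm_sq hy] at h2
      have h3 := hyk g hg
      have h4 := μ.cs hy hg
      have h5 : μ.nrm y ^ 2 ≤ η + B * δ + δ * (B + δ) := by
        have e1 := (abs_le.1 h1).2
        have e2 := (abs_le.1 h2).1
        have e3 : L y - η ≤ B * δ := e1
        nlinarith
      have h6 : |L g| ≤ (μ.nrm y + δ) * μ.nrm g := by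
        have := abs_sub_abs_le_abs_sub (L g) (μ fun x => y x * g x)
        nlinarith
      have h7 : (L g) ^ 2 ≤ ((μ.nrm y + δ) * μ.nrm g) ^ 2 := sq_le_sq' (abs_le.1 h6).1 (abs_le.1 h6).2
      refine h7.trans ?_
      rw [mul_pow]
      apply mul_le_mul_of_nonneg_right _ (sq_nonneg _)
      nlinarith)
  simpa using this

/-- two functionals -/
theorem PairBd {M : (P → ℝ) → ℝ} {B : ℝ} (hM : BLin M B) (hB : 0 ≤ B) {Ξ : P → Y → ℝ}
    (hΞ : ∀ p x, |Ξ p x| ≤ 1) {L' : (Y → ℝ) → ℝ} (hL' : Lin L') {A A' : ℝ} (hA : 0 ≤ A) (hA' : 0 ≤ A')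
    (h1 : ∀ g, Bdd g → (M fun p => μ fun x => g x * Ξ p x) ^ 2 ≤ A * μ fun x => g x * g x)
    (h2 : ∀ g, Bdd g → (L' g) ^ 2 ≤ A' * μ fun x => g x * g x)
    {g : Y → ℝ} (hg : Bdd g) :
    ((M fun p => μ fun x => g x * Ξ p x) - L' g) ^ 2 ≤
      (A + A' - 2 * M fun q => L' (Ξ q)) * μ fun x => g x * g x := by
  obtain ⟨hL, -⟩ := pairLin μ hM hΞ
  have hb : ∀ p, Bdd (Ξ p) := fun p => ⟨1, hΞ p⟩
  set L := fun g : Y → ℝ => M fun p => μ fun x => g x * Ξ p x with hLdef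
  have conv : ∀ (L : (Y → ℝ) → ℝ) (A : ℝ), 0 ≤ A → (∀ g, Bdd g → (L g) ^ 2 ≤ A * μ fun x => g x * g x) →
      ∀ g, Bdd g → |L g| ≤ √A * μ.nrm g := fun L A hA h g hg => by
    rw [Mean.nrm, ← Real.sqrt_mul hA]; exact Real.abs_le_sqrt (h g hg)
  have hLb := conv L A hA h1
  have hLb' := conv L' A' hA' h2
  set η := M fun q => L' (Ξ q)
  show (L g - L' g) ^ 2 ≤ _ * _
  rw [← μ.nrm_sq hg]
  have := le_of_cont (a := (L g - L' g) ^ 2)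
    (p := fun δ => (((√A + δ) ^ 2 + (√A' + δ) ^ 2 - 2 * η + 2 * (δ * (√A' + δ) + B * δ)) +
       2 * (√A + √A' + 2 * δ) * (2 * δ) + (2 * δ) ^ 2) * μ.nrm g ^ 2)
    (by fun_prop) (fun δ hδ => by
      obtain ⟨y, hy, hyn, hyk⟩ := RA μ hL _ (Real.sqrt_nonneg A) hLb δ hδ
      obtain ⟨z, hz, hzn, hzk⟩ := RA μ hL' _ (Real.sqrt_nonneg A') hLb' δ hδ
      have hyn0 := μ.nrm_nonneg y
      have hzn0 := μ.nrm_nonneg z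
      have hq : ∀ q, |(μ fun x => z x * Ξ q x) - L' (Ξ q)| ≤ δ := fun q => by
        rw [abs_sub_comm]
        exact (hzk _ (hb q)).trans (mul_le_of_le_one_right hδ.le (μ.nrm_le (hΞ q)))
      have hbL : Bdd fun q => L' (Ξ q) := ⟨√A', fun q => (hLb' _ (hb q)).trans
        (mul_le_of_le_one_right (Real.sqrt_nonneg _) (μ.nrm_le (hΞ q)))⟩
      have hby : Bdd fun q => μ fun x => z x * Ξ q x := by
        have := hbL.add (f := fun q => L' (Ξ q)) (g := fun q => (μ fun x => z x * Ξ q x) - L' (Ξ q)) ⟨δ, hq⟩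
        simpa using this
      have e1 := hM.bd _ _ hq
      rw [hM.toLin.sub hby hbL] at e1
      have e1' : |L z - η| ≤ B * δ := e1
      have e2 := hyk z hz
      have hD : Bdd fun x => y x + (-1) * z x := by simp [hy, hz]
      have e3 := μ.nrm_sq hD
      rw [μ.nrm_sq_expand hy hz, ← μ.nrm_sq hy, ← μ.nrm_sq hz] at e3
      set D := μ.nrm fun x => y x + (-1) * z x
      have hD0 : 0 ≤ D := μ.nrm_nonneg _
      have e4 := μ.cs hD hg
      have e5 : (μ fun x => (y x + (-1) * z x) * g x) = (μ fun x => y x * g x) - μ fun x => z x * g x := by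
        rw [← μ.sub (by simp [hy, hg]) (by simp [hz, hg])]; congr 1; ext x; ring
      rw [e5] at e4
      have e6 := hyk g hg
      have e7 := hzk g hg
      have h6 : |L g - L' g| ≤ (D + 2 * δ) * μ.nrm g := by
        rw [abs_le] at *; constructor <;> nlinarith
      have h7 := sq_le_sq' (abs_le.1 h6).1 (abs_le.1 h6).2
      refine h7.trans ?_
      rw [mul_pow]
      apply mul_le_mul_of_nonneg_right _ (sq_nonneg _)
      have hD2 : D ^ 2 ≤ (√A + δ) ^ 2 + (√A' + δ) ^ 2 - 2 * η + 2 * (δ * (√A' + δ) + B * δ) := by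
        have f1 := (abs_le.1 e1').1
        have f2 := (abs_le.1 e2).2
        have f3 : μ.nrm y ^ 2 ≤ (√A + δ) ^ 2 := pow_le_pow_left₀ hyn0 hyn 2
        have f4 : μ.nrm z ^ 2 ≤ (√A' + δ) ^ 2 := pow_le_pow_left₀ hzn0 hzn 2
        have f5 : δ * μ.nrm z ≤ δ * (√A' + δ) := mul_le_mul_of_nonneg_left hzn hδ.le
        nlinarith
      have hD3 : D ≤ √A + √A' + 2 * δ := by
        apply abs_le_of_sq_le_sq' _ (by positivity) |>.2
        have f3 := abs_le.1 (μ.cs hy hz)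
        have f4 : μ.nrm y * μ.nrm z ≤ (√A + δ) * (√A' + δ) := mul_le_mul hyn hzn hzn0 (by positivity)
        have f5 : μ.nrm y ^ 2 ≤ (√A + δ) ^ 2 := pow_le_pow_left₀ hyn0 hyn 2
        have f6 : μ.nrm z ^ 2 ≤ (√A' + δ) ^ 2 := pow_le_pow_left₀ hzn0 hzn 2
        nlinarith
      nlinarith)
  simpa [Real.sq_sqrt hA, Real.sq_sqrt hA'] using this
end RA
end SZ

namespace SZ
open Topology

noncomputable def ulim (U : Ultrafilter ℕ) (u : ℕ → ℝ) : ℝ := limUnder (U : Filter ℕ) u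

theorem ulim_tendsto (U : Ultrafilter ℕ) {u : ℕ → ℝ} (h : Bdd u) :
    Tendsto u U (𝓝 (ulim U u)) := by
  obtain ⟨C, h⟩ := h
  have hc : IsCompact (Set.Icc (-C) C) := isCompact_Icc
  obtain ⟨a, -, ha⟩ := hc.ultrafilter_le_nhds (U.map u) (by
    rw [le_principal_iff, Ultrafilter.coe_map, mem_map]
    exact Filter.univ_mem' fun n => abs_le.1 (h n))
  exact tendsto_nhds_limUnder ⟨a, ha⟩

noncomputable def avg {Y : Type} (w : ℕ → ℕ) (e : ℕ → ℕ → Y) (f : Y → ℝ) (n : ℕ) : ℝ :=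
  (∑ i ∈ Finset.range (w n + 1), f (e n i)) / (w n + 1)

theorem avg_bdd {Y : Type} (w : ℕ → ℕ) (e : ℕ → ℕ → Y) {f : Y → ℝ} (h : Bdd f) :
    Bdd (avg w e f) := by
  obtain ⟨C, h⟩ := h
  refine ⟨C, fun n => ?_⟩
  rw [avg, abs_div, abs_of_pos (show (0 : ℝ) < w n + 1 by positivity), div_le_iff₀ (by positivity)]
  refine (Finset.abs_sum_le_sum_abs _ _).trans ?_
  refine (Finset.sum_le_sum fun i _ => h (e n i)).trans ?_
  simp [mul_comm]

noncomputable def ultMean {Y : Type} (U : Ultrafilter ℕ) (w : ℕ → ℕ) (e : ℕ → ℕ → Y) : Mean Y where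
  f a := ulim U (avg w e a)
  add' a b ha hb := by
    refine tendsto_nhds_unique (ulim_tendsto U (avg_bdd w e (ha.add hb)))
      (((ulim_tendsto U (avg_bdd w e ha)).add (ulim_tendsto U (avg_bdd w e hb))).congr fun n => ?_)
    simp [avg, Finset.sum_add_distrib, add_div]
  smul' c a ha := by
    refine tendsto_nhds_unique (ulim_tendsto U (avg_bdd w e ((Bdd.const c).mul ha)))
      (((ulim_tendsto U (avg_bdd w e ha)).const_mul c).congr fun n => ?_)
    simp only [avg, ← Finset.mul_sum, mul_div_assoc]
  nonneg' a ha h := ge_of_tendsto' (ulim_tendsto U (avg_bdd w e ha)) fun n =>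
    div_nonneg (Finset.sum_nonneg fun i _ => h _) (by positivity)
  one' := by
    refine tendsto_nhds_unique (ulim_tendsto U (avg_bdd w e (Bdd.const 1)))
      (tendsto_const_nhds.congr fun n => ?_)
    have : (w n + 1 : ℝ) ≠ 0 := by positivity
    simp [avg, div_self this]

theorem ultMean_tendsto {Y : Type} (U : Ultrafilter ℕ) (w : ℕ → ℕ) (e : ℕ → ℕ → Y) {a : Y → ℝ} (ha : Bdd a) :
    Tendsto (avg w e a) U (𝓝 (ultMean U w e a)) := ulim_tendsto U (avg_bdd w e ha)

theorem ultMean_shift (U : Ultrafilter ℕ) (w : ℕ → ℕ) (hw : Tendsto w U atTop) (b : ℕ → ℤ) {a : ℤ → ℝ}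
    (ha : Bdd a) (t : ℤ) :
    ultMean U w (fun n i => b n + i) (fun x => a (x + t)) = ultMean U w (fun n i => b n + i) a := by
  have one : ∀ a : ℤ → ℝ, Bdd a → ultMean U w (fun n i => b n + i) (fun x => a (x + 1)) =
      ultMean U w (fun n i => b n + i) a := by
    intro a ha
    refine tendsto_nhds_unique (ultMean_tendsto U w _ (ha.comp fun x => x + 1)) ?_
    have h0 : Tendsto (fun n => (a (b n + ((w n + 1 : ℕ) : ℤ)) - a (b n)) / (w n + 1 : ℝ)) U (𝓝 0) := by
      obtain ⟨C, hC⟩ := ha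
      have h1 : Tendsto (fun n => (2 * C) / (w n + 1 : ℝ)) U (𝓝 0) := by
        refine Tendsto.div_atTop tendsto_const_nhds ?_
        exact tendsto_atTop_add_const_right _ _ (tendsto_natCast_atTop_atTop.comp hw)
      refine squeeze_zero_norm (fun n => ?_) h1
      rw [Real.norm_eq_abs, abs_div, abs_of_pos (show (0 : ℝ) < w n + 1 by positivity)]
      gcongr
      have h1 := abs_le.1 (hC (b n + ((w n + 1 : ℕ) : ℤ)))
      have h2 := abs_le.1 (hC (b n))
      rw [abs_le]; constructor <;> linarith
    have := (ultMean_tendsto U w (fun n i => b n + i) ha).add h0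
    rw [add_zero] at this
    refine this.congr fun n => ?_
    rw [avg, avg, ← add_div]; congr 1
    have := Finset.sum_range_succ' (fun i : ℕ => a (b n + i)) (w n + 1)
    rw [Finset.sum_range_succ] at this
    simp only [Nat.cast_zero, add_zero] at this
    have e : ∀ i : ℕ, b n + (i : ℤ) + 1 = b n + ((i + 1 : ℕ) : ℤ) := fun i => by push_cast; ring
    simp only [e]
    linarith
  induction t using Int.induction_on with
  | zero => simp
  | succ i ih =>
    rw [← ih, ← one (fun x => a (x + i)) (ha.comp _)]
    congr 1; ext x; congr 1; ring
  | pred i ih =>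
    rw [← ih, ← one (fun x => a (x + (-(i : ℤ) - 1))) (ha.comp _)]
    congr 1; ext x; congr 1; ring

noncomputable def E : Mean ℤ := ultMean (hyperfilter ℕ) id (fun _ i => 0 + (i : ℤ))

theorem hyper_le : ((hyperfilter ℕ : Ultrafilter ℕ) : Filter ℕ) ≤ atTop := by
  rw [← Nat.cofinite_eq_atTop]; exact hyperfilter_le_cofinite

theorem E_shift {a : ℤ → ℝ} (ha : Bdd a) (t : ℤ) : E (fun x => a (x + t)) = E a :=
  ultMean_shift _ _ (hyper_le) (fun _ => 0) ha t

/-- Lower bound from finite averages. -/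
theorem E_ge {a : ℤ → ℝ} (ha : Bdd a) {c : ℝ}
    (h : ∀ᶠ n : ℕ in atTop, c ≤ (∑ i ∈ Finset.range (n + 1), a i) / (n + 1)) : c ≤ E a := by
  refine ge_of_tendsto (ultMean_tendsto (hyperfilter ℕ) id _ ha) (hyper_le ?_)
  filter_upwards [h] with n hn
  simpa [avg] using hn

attribute [irreducible] E

def Mean.map {Y Z : Type} (μ : Mean Y) (e : Y → Z) : Mean Z where
  f a := μ fun y => a (e y)
  add' a b ha hb := μ.add (ha.comp e) (hb.comp e)
  smul' c a ha := μ.smul c (ha.comp e)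
  nonneg' a ha h := μ.nonneg (ha.comp e) fun x => h _
  one' := by simp

structure Sys (G Y : Type) [AddCommGroup G] where
  act : G → Y → Y
  zero : ∀ x, act 0 x = x
  add : ∀ a b x, act (a + b) x = act a (act b x)
  μ : Mean Y
  inv : ∀ g f, Bdd f → μ (fun x => f (act g x)) = μ f

def Sys.pr {G Y P : Type} [AddCommGroup G] (S : Sys G Y) (M : Mean P) : Sys (P → G) (Y × P) where
  act g x := (S.act (g x.2) x.1, x.2)
  zero x := by simp [S.zero]
  add a b x := by simp [S.add]
  μ := S.μ.prod M
  inv g f hf := by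
    simp only [Mean.prod_apply]
    congr 1; ext p
    exact S.inv (g p) (fun x => f (x, p)) (hf.comp _)

/-- The two orders of double averages on `ℤ × ℤ`. -/
noncomputable def E12 : Mean (ℤ × ℤ) := E.prod E
noncomputable def E21 : Mean (ℤ × ℤ) := (E.prod E).map Prod.swap
theorem E12_apply (a : ℤ × ℤ → ℝ) : E12 a = E fun n => E fun m => a (m, n) := rfl
theorem E21_apply (a : ℤ × ℤ → ℝ) : E21 a = E fun m => E fun n => a (m, n) := rfl
theorem E12_shift {a : ℤ × ℤ → ℝ} (ha : Bdd a) (q : ℤ × ℤ) : E12 (fun p => a (p + q)) = E12 a := by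
  rw [E12_apply, E12_apply]
  rw [← E_shift (a := fun n => E fun m => a (m, n)) (by simp [ha.comp fun q : ℤ × ℤ => (q.2, q.1)]) q.2]
  congr 1; ext n
  exact E_shift (a := fun m => a (m, n + q.2)) (ha.comp _) q.1
theorem E21_shift {a : ℤ × ℤ → ℝ} (ha : Bdd a) (q : ℤ × ℤ) : E21 (fun p => a (p + q)) = E21 a := by
  have := E12_shift (a := fun p => a p.swap) (ha.comp _) q.swap
  exact this

theorem prod_abs_le {I : Type} (s : Finset I) {f : I → ℝ} (h : ∀ i, |f i| ≤ 1) : |∏ i ∈ s, f i| ≤ 1 := by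
  rw [Finset.abs_prod]; exact Finset.prod_le_one (fun i _ => abs_nonneg _) fun i _ => h i

theorem mul_abs_le {a b : ℝ} (ha : |a| ≤ 1) (hb : |b| ≤ 1) : |a * b| ≤ 1 := by
  rw [abs_mul]; exact mul_le_one₀ ha (abs_nonneg _) hb

def phi {G Y J : Type} [AddCommGroup G] [Fintype J] (S : Sys G Y) {r : ℕ} (F : Fin r → Y → ℝ) (A B : Fin r → G)
    (F' : J → Y → ℝ) (A' B' : J → G) (W : G) (m n : ℤ) : ℝ :=
  S.μ fun x => (∏ i, F i (S.act (m • A i + n • B i) x)) *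
    ∏ j, F' j (S.act (m • A' j + n • B' j + (m * n) • W) x)

def Swaps {G Y J : Type} [AddCommGroup G] [Fintype J] (S : Sys G Y) {r : ℕ} (F : Fin r → Y → ℝ) (A B : Fin r → G)
    (F' : J → Y → ℝ) (A' B' : J → G) (W : G) : Prop :=
  E12 (fun p => phi S F A B F' A' B' W p.1 p.2) = E21 (fun p => phi S F A B F' A' B' W p.1 p.2)

theorem buc_ind (K : Type → Prop) (hK : ∀ J, K J → K (J ⊕ J))
    (base : ∀ (G Y J : Type) [AddCommGroup G] [Fintype J] (S : Sys G Y) (F : Fin 0 → Y → ℝ) (A B : Fin 0 → G)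
      (F' : J → Y → ℝ) (_ : ∀ j x, |F' j x| ≤ 1) (A' B' : J → G) (W : G), K J → Swaps S F A B F' A' B' W)
    (r : ℕ) : ∀ (G Y J : Type) [AddCommGroup G] [Fintype J] (S : Sys G Y) (F : Fin r → Y → ℝ)
      (_ : ∀ j x, |F j x| ≤ 1) (A B : Fin r → G)
      (F' : J → Y → ℝ) (_ : ∀ j x, |F' j x| ≤ 1) (A' B' : J → G) (W : G), K J → Swaps S F A B F' A' B' W := by
  induction r with
  | zero => intro G Y J _ _ S F _ A B F' hF' A' B' W hJ; exact base G Y J S F A B F' hF' A' B' W hJ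
  | succ r ih =>
    intro G Y J _ _ S F hF A B F' hF' A' B' W hJ
    let a : Fin r → G := fun i => A i.succ - A 0
    let b : Fin r → G := fun i => B i.succ - B 0
    let a' : J → G := fun j => A' j - A 0
    let b' : J → G := fun j => B' j - B 0
    let Ξ : ℤ × ℤ → Y → ℝ := fun p x => (∏ i : Fin r, F i.succ (S.act (p.1 • a i + p.2 • b i) x)) *
      ∏ j, F' j (S.act (p.1 • a' j + p.2 • b' j + (p.1 * p.2) • W) x)
    have hΞ : ∀ p x, |Ξ p x| ≤ 1 := fun p x =>
      mul_abs_le (prod_abs_le _ fun i => hF _ _) (prod_abs_le _ fun i => hF' _ _)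
    have bΞ : ∀ (Z : Type) (i : Z → ℤ × ℤ) (e : Z → Y), Bdd (fun q => Ξ (i q) (e q)) :=
      fun Z i e => ⟨1, fun q => hΞ _ _⟩
    have h1 : ∀ p : ℤ × ℤ, phi S F A B F' A' B' W p.1 p.2 = S.μ fun x => F 0 x * Ξ p x := by
      rintro ⟨m, n⟩
      have hb : Bdd fun x => F 0 x * Ξ (m, n) x := ⟨1, fun x => mul_abs_le (hF _ _) (hΞ _ _)⟩
      rw [← S.inv (m • A 0 + n • B 0) _ hb, phi]
      congr 1; ext x
      rw [Fin.prod_univ_succ, mul_assoc]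
      congr 1
      simp only [Ξ, ← S.add]
      congr 1
      · refine Finset.prod_congr rfl fun i _ => ?_
        congr 2; simp only [a, b, smul_sub]; abel
      · refine Finset.prod_congr rfl fun i _ => ?_
        congr 2; simp only [a', b', smul_sub]; abel
    have key : ∀ M : Mean (ℤ × ℤ), (∀ (f : ℤ × ℤ → ℝ), Bdd f → ∀ q, M (fun p => f (p + q)) = M f) →
        E12 (fun q => M fun p => S.μ fun x => Ξ q x * Ξ p x) =
        E21 (fun q => M fun p => S.μ fun x => Ξ q x * Ξ p x) := by
      intro M hM
      have := ih (ℤ × ℤ → G) (Y × (ℤ × ℤ)) (J ⊕ J) (S.pr M)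
        (fun i y => F i.succ y.1 * F i.succ (S.act (y.2.1 • a i + y.2.2 • b i) y.1))
        (fun i y => mul_abs_le (hF _ _) (hF _ _)) (fun i _ => a i) (fun i _ => b i)
        (Sum.elim (fun j y => F' j y.1)
          (fun j y => F' j (S.act (y.2.1 • a' j + y.2.2 • b' j + (y.2.1 * y.2.2) • W) y.1)))
        (by rintro (j | j) y <;> exact hF' _ _)
        (Sum.elim (fun j _ => a' j) (fun j p => a' j + p.2 • W))
        (Sum.elim (fun j _ => b' j) (fun j p => b' j + p.1 • W)) (fun _ => W) (hK _ hJ)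
      have e : ∀ q : ℤ × ℤ, phi (S.pr M)
        (fun i y => F i.succ y.1 * F i.succ (S.act (y.2.1 • a i + y.2.2 • b i) y.1))
        (fun i _ => a i) (fun i _ => b i)
        (Sum.elim (fun j y => F' j y.1)
          (fun j y => F' j (S.act (y.2.1 • a' j + y.2.2 • b' j + (y.2.1 * y.2.2) • W) y.1)))
        (Sum.elim (fun j _ => a' j) (fun j p => a' j + p.2 • W))
        (Sum.elim (fun j _ => b' j) (fun j p => b' j + p.1 • W)) (fun _ => W) q.1 q.2 =
        M fun p => S.μ fun x => Ξ q x * Ξ p x := by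
        intro q
        rw [← hM (fun p => S.μ fun x => Ξ q x * Ξ p x) (by simp [bΞ]) q]
        simp only [phi, Sys.pr, Mean.prod_apply]
        congr 1; ext p; congr 1; ext x
        simp only [Ξ, Fintype.prod_sum_type, Sum.elim_inl, Sum.elim_inr, Finset.prod_mul_distrib,
          Pi.add_apply, Pi.smul_apply, ← S.add]
        have e1 : ∀ i, p.1 • a i + p.2 • b i + (q.1 • a i + q.2 • b i) =
          (p + q).1 • a i + (p + q).2 • b i := fun i => by
            simp only [Prod.fst_add, Prod.snd_add, add_smul]; abel
        have e2 : ∀ j, p.1 • a' j + p.2 • b' j + (p.1 * p.2) • W +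
            (q.1 • (a' j + p.2 • W) + q.2 • (b' j + p.1 • W) + (q.1 * q.2) • W) =
            (p + q).1 • a' j + (p + q).2 • b' j + ((p + q).1 * (p + q).2) • W := fun j => by
          simp only [Prod.fst_add, Prod.snd_add]; module
        simp only [e1, e2]
        ring
      rw [Swaps] at this
      simpa only [e] using this
    have hM : BLin (fun f : ℤ × ℤ → ℝ => E12 f - E21 f) (1 + 1) := (Mean.blin E12).sub (Mean.blin E21)
    have hR := RR S.μ hM (by norm_num) hΞ (g := F 0) ⟨1, hF 0⟩
    have hbd : ∀ M : Mean (ℤ × ℤ), Bdd fun q => M fun p => S.μ fun x => Ξ q x * Ξ p x := fun M => by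
      simp (maxDischargeDepth := 9) [bΞ]
    have hz : E12 (fun q => (E12 fun p => S.μ fun x => Ξ q x * Ξ p x) - E21 fun p => S.μ fun x => Ξ q x * Ξ p x)
      - E21 (fun q => (E12 fun p => S.μ fun x => Ξ q x * Ξ p x) - E21 fun p => S.μ fun x => Ξ q x * Ξ p x) = 0 := by
      rw [E12.sub (hbd _) (hbd _), E21.sub (hbd _) (hbd _), key E12 fun f hf q => E12_shift hf q,
        key E21 fun f hf q => E21_shift hf q]
      ring
    rw [hz, zero_mul] at hR
    have := pow_eq_zero_iff (two_ne_zero) |>.1 (le_antisymm hR (sq_nonneg _))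
    rw [Swaps]; simp only [h1]; linarith

theorem swap_lin_fin (r : ℕ) (G Y : Type) [AddCommGroup G] (S : Sys G Y) (F : Fin r → Y → ℝ)
      (hF : ∀ j x, |F j x| ≤ 1) (A B : Fin r → G) :
    E12 (fun p => S.μ fun x => ∏ i, F i (S.act (p.1 • A i + p.2 • B i) x)) =
    E21 (fun p => S.μ fun x => ∏ i, F i (S.act (p.1 • A i + p.2 • B i) x)) := by
  have := buc_ind (fun J => IsEmpty J) (fun J h => by infer_instance)
    (fun G Y J _ _ S F A B F' hF' A' B' W hJ => by simp [Swaps, phi]) r G Y Empty S F hF A B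
    (fun j => j.elim) (fun j => j.elim) (fun j => j.elim) (fun j => j.elim) 0 (by infer_instance)
  simpa [Swaps, phi] using this

theorem swap_lin {G Y I : Type} [AddCommGroup G] [Fintype I] (S : Sys G Y) (F : I → Y → ℝ)
      (hF : ∀ j x, |F j x| ≤ 1) (A B : I → G) :
    E12 (fun p => S.μ fun x => ∏ i, F i (S.act (p.1 • A i + p.2 • B i) x)) =
    E21 (fun p => S.μ fun x => ∏ i, F i (S.act (p.1 • A i + p.2 • B i) x)) := by
  let e := Fintype.equivFin I
  have := swap_lin_fin (Fintype.card I) G Y S (fun i => F (e.symm i)) (fun i => hF _)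
    (fun i => A (e.symm i)) (fun i => B (e.symm i))
  have h : ∀ (p : ℤ × ℤ) x, ∏ i, F (e.symm i) (S.act (p.1 • A (e.symm i) + p.2 • B (e.symm i)) x)
    = ∏ i, F i (S.act (p.1 • A i + p.2 • B i) x) := fun p x =>
      Equiv.prod_comp e.symm (fun i => F i (S.act (p.1 • A i + p.2 • B i) x))
  simpa only [h] using this

theorem swap_bil {G Y I J : Type} [AddCommGroup G] [Fintype I] [Fintype J] (S : Sys G Y) (F : I → Y → ℝ)
      (hF : ∀ j x, |F j x| ≤ 1) (A B : I → G) (F' : J → Y → ℝ) (hF' : ∀ j x, |F' j x| ≤ 1) (A' B' : J → G) (W : G) :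
    E12 (fun p => S.μ fun x => (∏ i, F i (S.act (p.1 • A i + p.2 • B i) x)) *
      ∏ j, F' j (S.act (p.1 • A' j + p.2 • B' j + (p.1 * p.2) • W) x)) =
    E21 (fun p => S.μ fun x => (∏ i, F i (S.act (p.1 • A i + p.2 • B i) x)) *
      ∏ j, F' j (S.act (p.1 • A' j + p.2 • B' j + (p.1 * p.2) • W) x)) := by
  let e := Fintype.equivFin I
  have := buc_ind (fun J => True) (fun J h => trivial)
    (fun G Y J _ _ S F A B F' hF' A' B' W hJ => by
      have h : ∀ m n, phi S F A B F' A' B' W m n = S.μ fun x => ∏ j, F' j (S.act (m • A' j + n • B' j) x) := by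
        intro m n
        rw [← S.inv ((m * n) • W) _ ⟨1, fun x => prod_abs_le _ fun i => hF' _ _⟩, phi]
        simp [← S.add]
      simp only [Swaps, h]
      exact swap_lin S F' hF' A' B') (Fintype.card I) G Y J S (fun i => F (e.symm i)) (fun i => hF _)
    (fun i => A (e.symm i)) (fun i => B (e.symm i)) F' hF' A' B' W trivial
  have h : ∀ (p : ℤ × ℤ) x, ∏ i, F (e.symm i) (S.act (p.1 • A (e.symm i) + p.2 • B (e.symm i)) x)
    = ∏ i, F i (S.act (p.1 • A i + p.2 • B i) x) := fun p x =>
      Equiv.prod_comp e.symm (fun i => F i (S.act (p.1 • A i + p.2 • B i) x))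
  simpa only [h, Swaps, phi] using this
end SZ

namespace SZ
open Topology

theorem BLin.bdd {P Y : Type} {M : (P → ℝ) → ℝ} {B : ℝ} (h : BLin M B) {Φ : Y → P → ℝ}
    (hΦ : Bdd (fun q : Y × P => Φ q.1 q.2)) : Bdd (fun y => M (Φ y)) := by
  obtain ⟨C, hC⟩ := hΦ
  exact ⟨B * C, fun y => h.bd _ _ fun p => hC (y, p)⟩

theorem BLin.sum {P I : Type} {M : (P → ℝ) → ℝ} {B : ℝ} (h : BLin M B) (s : Finset I) {f : I → P → ℝ}
    (hf : ∀ i ∈ s, Bdd (f i)) : M (fun x => ∑ i ∈ s, f i x) = ∑ i ∈ s, M (f i) := by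
  classical
  induction s using Finset.induction_on with
  | empty => simpa using h.smul 0 (fun _ => 0) (by simp)
  | insert a s ha ih =>
    simp only [Finset.sum_insert ha]
    rw [h.add _ _ (hf a (by simp)) (Bdd.sum s fun i hi => hf i (by simp [hi])),
      ih fun i hi => hf i (by simp [hi])]

theorem BLin.prod {P P' : Type} {M : (P → ℝ) → ℝ} {M' : (P' → ℝ) → ℝ} {B B' : ℝ}
    (h : BLin M B) (h' : BLin M' B') :
    BLin (fun Φ : P × P' → ℝ => M fun p => M' fun p' => Φ (p, p')) (B * B') where
  add a b ha hb := by
    rw [← h.add _ _ (h'.bdd (ha.comp _)) (h'.bdd (hb.comp _))]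
    congr 1; ext p
    exact h'.add _ _ (ha.comp _) (hb.comp _)
  smul c a ha := by
    rw [← h.smul _ _ (h'.bdd (ha.comp _))]
    congr 1; ext p
    exact h'.smul _ _ (ha.comp _)
  bd a c hc := by
    rw [mul_assoc]
    exact h.bd _ _ fun p => h'.bd _ _ fun p' => hc _

structure Fam (P : Type) (τ : ℤ → P → P) (D : ℤ → (P → ℝ) → ℝ) (N : ℤ → ℤ) (B : ℝ) (T X : ℕ) : Prop where
  act : ∀ a p, τ a (τ (-a) p) = p
  blin : ∀ k, BLin (D k) B
  ne : ∀ k, N k ≠ 0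
  cop : ∀ k t : ℤ, T ≤ t → t ≤ X → IsCoprime (N k) (N (k + t))
  inv : ∀ k a φ, Bdd φ → D k (fun p => φ (τ (a * N k) p)) = D k φ
  kill : ∀ k b φ, Bdd φ → b ≠ 0 → IsCoprime b (N k) → (∀ c p, φ (τ (c * b) p) = φ p) → D k φ = 0

theorem Fam.cop2 {P : Type} {τ : ℤ → P → P} {D : ℤ → (P → ℝ) → ℝ} {N : ℤ → ℤ} {B : ℝ} {T X : ℕ}
    (h : Fam P τ D N B T X) {a b : ℤ} (h1 : T ≤ |a - b|) (h2 : |a - b| ≤ X) : IsCoprime (N a) (N b) := by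
  rcases le_total a b with hab | hab
  · rw [abs_sub_comm, abs_of_nonneg (by linarith)] at h1 h2
    simpa using h.cop a (b - a) h1 h2
  · rw [abs_of_nonneg (by linarith)] at h1 h2
    simpa using (h.cop b (a - b) h1 h2).symm

theorem Fam.prod {P : Type} {τ : ℤ → P → P} {D : ℤ → (P → ℝ) → ℝ} {N : ℤ → ℤ} {B : ℝ} {T X H : ℕ}
    (h : Fam P τ D N B T (X + T * H)) {t t' : ℕ} (ht : t < H) (ht' : t' < H) (hne : t ≠ t') :
    Fam (P × P) (fun a p => (τ a p.1, τ a p.2))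
      (fun k Φ => D (k + t * T) fun p => D (k + t' * T) fun p' => Φ (p, p'))
      (fun k => N (k + t * T) * N (k + t' * T)) (B * B) (T * (H + 1)) X where
  act a p := by simp [h.act]
  blin k := (h.blin _).prod (h.blin _)
  ne k := mul_ne_zero (h.ne _) (h.ne _)
  cop k u hu hu' := by
    have hT : (0 : ℤ) ≤ T := by positivity
    have a1 : (0 : ℤ) ≤ t * T := by positivity
    have a2 : (0 : ℤ) ≤ t' * T := by positivity
    have a3 : (t * T : ℤ) ≤ T * H := by rw [mul_comm]; exact_mod_cast Nat.mul_le_mul_left T ht.le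
    have a4 : (t' * T : ℤ) ≤ T * H := by rw [mul_comm]; exact_mod_cast Nat.mul_le_mul_left T ht'.le
    push_cast at hu
    have key : ∀ v w : ℤ, 0 ≤ v → v ≤ T * H → 0 ≤ w → w ≤ T * H → IsCoprime (N (k + v)) (N (k + u + w)) := by
      intro v w hv hv' hw hw'
      apply h.cop2
      · rw [abs_sub_comm, abs_of_nonneg (by nlinarith)]; nlinarith
      · rw [abs_sub_comm, abs_of_nonneg (by nlinarith)]; push_cast; nlinarith
    exact ((key _ _ a1 a3 a1 a3).mul_left (key _ _ a2 a4 a1 a3)).mul_right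
      ((key _ _ a1 a3 a2 a4).mul_left (key _ _ a2 a4 a2 a4))
  inv k a φ hφ := by
    have e1 : ∀ p, D (k + t' * T) (fun p' => φ (p, τ (a * (N (k + t * T) * N (k + t' * T))) p')) =
        D (k + t' * T) (fun p' => φ (p, p')) := fun p => by
      have := h.inv (k + t' * T) (a * N (k + t * T)) (fun p' => φ (p, p')) (hφ.comp _)
      rw [← this]; simp only [mul_assoc]
    simp only [e1]
    have := h.inv (k + t * T) (a * N (k + t' * T)) (fun p => D (k + t' * T) (fun p' => φ (p, p')))
      ((h.blin _).bdd (hφ.comp _))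
    rw [← this]
    congr 1; ext p; congr 1; ext p'; congr 3; ring
  kill k b φ hφ hb hc hper := by
    refine h.kill (k + t * T) (b * N (k + t' * T)) _ ((h.blin _).bdd (hφ.comp _))
      (mul_ne_zero hb (h.ne _)) ?_ ?_
    · refine IsCoprime.mul_left (IsCoprime.of_mul_right_left hc) ?_
      have hd : (1 : ℤ) ≤ |(t' : ℤ) - t| := Int.one_le_abs (by omega)
      have hd' : |(t' : ℤ) - t| ≤ H := by rw [abs_le]; constructor <;> omega
      have e : |k + t' * T - (k + t * T)| = |(t' : ℤ) - t| * T := by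
        rw [show k + t' * T - (k + t * T) = ((t' : ℤ) - t) * T by ring, abs_mul,
          abs_of_nonneg (show (0 : ℤ) ≤ T by positivity)]
      have hT : (0 : ℤ) ≤ T := by positivity
      apply h.cop2
      · rw [e]; nlinarith
      · rw [e]; push_cast; nlinarith
    · intro c p
      have := h.inv (k + t' * T) (-c * b) (fun p' => φ (p, p')) (hφ.comp _)
      rw [← this]
      congr 1; ext p'
      have h2 := hper (c * N (k + t' * T)) (p, τ (-c * b * N (k + t' * T)) p')
      rw [← h2]
      have e : -c * b * N (k + t' * T) = -(c * N (k + t' * T) * b) := by ring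
      rw [e, h.act]
      congr 3; ring

theorem RT (r : ℕ) : ∀ ε : ℝ, 0 < ε → ∀ B : ℝ, 0 ≤ B → ∀ T : ℕ, 1 ≤ T → ∃ X : ℕ,
    ∀ (P : Type) (τ : ℤ → P → P) (D : ℤ → (P → ℝ) → ℝ) (N : ℤ → ℤ), Fam P τ D N B T X →
    ∀ (m0 Q : ℤ) (G Y : Type) [AddCommGroup G] (S : Sys G Y) (F : Fin r → Y → ℝ), (∀ i x, |F i x| ≤ 1) →
    ∀ (R : Fin r → G) (W : G) (Z : ℤ → P → Y → ℝ), (∀ k p x, |Z k p x| ≤ 1) →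
    (∀ k a p x, Z k (τ a p) x = Z k p (S.act (a • W) x)) →
    |E fun k => D k fun p => S.μ fun x => (∏ i, F i (S.act ((m0 + Q * k) • R i) x)) * Z k p x| ≤ ε := by
  induction r with
  | zero =>
    intro ε hε B hB T hT
    refine ⟨0, fun P τ D N hF m0 Q G Y _ S F _ R W Z hZ hZe => ?_⟩
    have : ∀ k, (D k fun p => S.μ fun x => (∏ i, F i (S.act ((m0 + Q * k) • R i) x)) * Z k p x) = 0 := by
      intro k
      simp only [Finset.univ_eq_empty, Finset.prod_empty, one_mul]
      refine hF.kill k 1 _ ⟨1, fun p => S.μ.absle fun x => hZ _ _ _⟩ one_ne_zero isCoprime_one_left ?_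
      intro c p
      simp only [hZe]
      exact S.inv _ _ ⟨1, hZ k p⟩
    simp only [this, Mean.const, abs_zero]
    exact hε.le
  | succ r ih =>
    intro ε hε B hB T hT
    obtain ⟨H, hH⟩ := exists_nat_gt (2 * (B * B) / ε ^ 2)
    have hH0 : 0 < H := by
      have : (0 : ℝ) < H := lt_of_le_of_lt (by positivity) hH
      exact_mod_cast this
    have hHr : (0 : ℝ) < H := by exact_mod_cast hH0
    obtain ⟨X, hX⟩ := ih (ε ^ 2 / 2) (by positivity) (B * B) (by positivity) (T * (H + 1)) (by nlinarith)
    refine ⟨X + T * H, fun P τ D N hFam m0 Q G Y _ S F hF R W Z hZ hZe => ?_⟩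
    -- normalise
    let m : ℤ → ℤ := fun k => m0 + Q * k
    let R' : Fin r → G := fun i => R i.succ - R 0
    let Z' : ℤ → P → Y → ℝ := fun k p x => Z k p (S.act (-(m k • R 0)) x)
    let Ξ : ℤ → P → Y → ℝ := fun k p x => (∏ i : Fin r, F i.succ (S.act (m k • R' i) x)) * Z' k p x
    have hΞ : ∀ k p x, |Ξ k p x| ≤ 1 := fun k p x => mul_abs_le (prod_abs_le _ fun i => hF _ _) (hZ _ _ _)
    have h1 : ∀ k p, (S.μ fun x => (∏ i, F i (S.act ((m0 + Q * k) • R i) x)) * Z k p x) =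
        S.μ fun x => F 0 x * Ξ k p x := by
      intro k p
      have hb : Bdd fun x => F 0 x * Ξ k p x := ⟨1, fun x => mul_abs_le (hF _ _) (hΞ _ _ _)⟩
      rw [← S.inv (m k • R 0) _ hb]
      congr 1; ext x
      rw [Fin.prod_univ_succ, mul_assoc]
      congr 1
      simp only [Ξ, Z', ← S.add, R', smul_sub, sub_add_cancel, neg_add_cancel, S.zero]
      rfl
    simp only [h1]
    have hbL : ∀ k, |D k fun p => S.μ fun x => F 0 x * Ξ k p x| ≤ B := fun k => by
      simpa using (hFam.blin k).bd _ 1 fun p => S.μ.absle fun x => mul_abs_le (hF _ _) (hΞ _ _ _)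
    set L : ℤ → ℝ := fun k => D k fun p => S.μ fun x => F 0 x * Ξ k p x with hL
    have hLb : Bdd L := ⟨B, hbL⟩
    -- averaged functional
    let M : ℤ → (Fin H × P → ℝ) → ℝ := fun k a => (1 / (H : ℝ)) * ∑ t : Fin H, D (k + t * T) fun p => a (t, p)
    have hM : ∀ k, BLin (M k) B := fun k => {
      add := fun a b ha hb => by
        simp only [M]
        rw [← mul_add, ← Finset.sum_add_distrib]
        congr 1; refine Finset.sum_congr rfl fun t _ => ?_
        exact (hFam.blin _).add _ _ (ha.comp _) (hb.comp _)
      smul := fun c a ha => by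
        simp only [M]
        rw [mul_left_comm]
        congr 1; rw [Finset.mul_sum]; refine Finset.sum_congr rfl fun t _ => ?_
        exact (hFam.blin _).smul _ _ (ha.comp _)
      bd := fun a c hc => by
        simp only [M]
        rw [abs_mul, abs_of_nonneg (by positivity), one_div, inv_mul_le_iff₀ hHr]
        refine (Finset.abs_sum_le_sum_abs _ _).trans ?_
        refine (Finset.sum_le_sum fun t _ => (hFam.blin _).bd _ c fun p => hc (t, p)).trans ?_
        simp }
    let ΞM : ℤ → Fin H × P → Y → ℝ := fun k p => Ξ (k + p.1 * T) p.2
    have h2 : ∀ k, (M k fun p => S.μ fun x => F 0 x * ΞM k p x) = (1 / (H : ℝ)) * ∑ t : Fin H, L (k + t * T) :=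
      fun k => rfl
    have hbA : Bdd fun k => (1 / (H : ℝ)) * ∑ t : Fin H, L (k + t * T) :=
      (Bdd.const _).mul (Bdd.sum _ fun t _ => hLb.comp _)
    have h3 : E L = E fun k => (1 / (H : ℝ)) * ∑ t : Fin H, L (k + t * T) := by
      rw [E.smul _ (Bdd.sum _ fun t _ => hLb.comp _), E.sum _ fun t _ => hLb.comp _]
      simp only [E_shift hLb]
      simp; field_simp
    let V : ℤ → Fin H → Fin H → ℝ := fun k t t' => D (k + t * T) fun p => D (k + t' * T) fun p' =>
      S.μ fun x => Ξ (k + t * T) p x * Ξ (k + t' * T) p' x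
    have hVb : ∀ k t t', |V k t t'| ≤ B * B := fun k t t' => by
      have := ((hFam.blin (k + t * T)).prod (hFam.blin (k + t' * T))).bd
        (fun q => S.μ fun x => Ξ (k + t * T) q.1 x * Ξ (k + t' * T) q.2 x) 1
        (fun q => S.μ.absle fun x => mul_abs_le (hΞ _ _ _) (hΞ _ _ _))
      simpa using this
    have h4 : ∀ k, ((1 / (H : ℝ)) * ∑ t : Fin H, L (k + t * T)) ^ 2 ≤
        (1 / (H : ℝ)) ^ 2 * ∑ t : Fin H, ∑ t' : Fin H, V k t t' := by
      intro k
      have hR := RR S.μ (hM k) hB (Ξ := ΞM k) (fun p x => hΞ _ _ _) (g := F 0) ⟨1, hF 0⟩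
      rw [h2] at hR
      refine hR.trans ?_
      have e : (M k fun q => M k fun p => S.μ fun x => ΞM k q x * ΞM k p x) =
          (1 / (H : ℝ)) ^ 2 * ∑ t : Fin H, ∑ t' : Fin H, V k t t' := by
        simp only [M, ΞM, V]
        rw [pow_two, mul_assoc]
        congr 1; rw [Finset.mul_sum]; refine Finset.sum_congr rfl fun t _ => ?_
        have hb : ∀ t' : Fin H, Bdd fun p => D (k + t' * T) fun p' =>
          S.μ fun x => Ξ (k + t * T) p x * Ξ (k + t' * T) p' x := fun t' =>
          (hFam.blin _).bdd ⟨1, fun q => S.μ.absle fun x => mul_abs_le (hΞ _ _ _) (hΞ _ _ _)⟩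
        rw [(hFam.blin _).smul _ _ (Bdd.sum _ fun t' _ => hb t'), (hFam.blin _).sum _ fun t' _ => hb t']
      have e1 : (S.μ fun x => F 0 x * F 0 x) ≤ 1 := (le_abs_self _).trans
        (S.μ.absle fun x => mul_abs_le (hF _ _) (hF _ _))
      have e0 : 0 ≤ (1 / (H : ℝ)) ^ 2 * ∑ t : Fin H, ∑ t' : Fin H, V k t t' := by
        rw [← e]
        have hR1 := RR S.μ (hM k) hB (Ξ := ΞM k) (fun p x => hΞ _ _ _) (g := fun _ => 1) (by simp)
        simpa using (sq_nonneg _).trans hR1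
      rw [e]
      exact mul_le_of_le_one_right e0 e1
    have hVB : ∀ t t', Bdd fun k => V k t t' := fun t t' => ⟨B * B, fun k => hVb k t t'⟩
    have h5 : ∀ t t' : Fin H, t ≠ t' → (E fun k => V k t t') ≤ ε ^ 2 / 2 := by
      intro t t' hne
      have := hX (P × P) _ _ _ (hFam.prod t.2 t'.2 (fun h => hne (Fin.ext h))) m0 Q G Y S
        (fun i x => F i.succ (S.act ((Q * (t * T)) • R' i) x) * F i.succ (S.act ((Q * (t' * T)) • R' i) x))
        (fun i x => mul_abs_le (hF _ _) (hF _ _)) R' W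
        (fun k p x => Z' (k + t * T) p.1 x * Z' (k + t' * T) p.2 x)
        (fun k p x => mul_abs_le (hZ _ _ _) (hZ _ _ _))
        (fun k a p x => by
          simp only [Z', hZe, ← S.add]
          congr 3 <;> rw [add_comm])
      refine (le_abs_self _).trans (le_trans (le_of_eq ?_) this)
      congr 2; ext k; simp only [V]
      congr 1; ext p; congr 1; ext p'; congr 1; ext x
      simp only [Ξ, Finset.prod_mul_distrib, ← S.add, ← add_smul, m]
      have e : ∀ t : ℤ, Q * t + (m0 + Q * k) = m0 + Q * (k + t) := fun t => by ring
      simp only [e]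
      ring
    have h6 : (E L) ^ 2 ≤ ε ^ 2 := by
      have c1 := E.cs_sq hbA (Bdd.const (1 : ℝ))
      simp only [mul_one, Mean.const] at c1
      rw [← h3] at c1
      refine c1.trans ?_
      have c2 : (E fun k => ((1 / (H : ℝ)) * ∑ t : Fin H, L (k + t * T)) *
          ((1 / (H : ℝ)) * ∑ t : Fin H, L (k + t * T))) ≤
          E fun k => (1 / (H : ℝ)) ^ 2 * ∑ t : Fin H, ∑ t' : Fin H, V k t t' :=
        E.mono (hbA.mul hbA) ((Bdd.const _).mul (Bdd.sum _ fun t _ => Bdd.sum _ fun t' _ => hVB t t'))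
          fun k => by rw [← pow_two]; exact h4 k
      refine c2.trans ?_
      rw [E.smul _ (Bdd.sum _ fun t _ => Bdd.sum _ fun t' _ => hVB t t'),
        E.sum _ fun t _ => Bdd.sum _ fun t' _ => hVB t t']
      have c3 : ∀ t : Fin H, (E fun k => ∑ t' : Fin H, V k t t') ≤ B * B + H * (ε ^ 2 / 2) := by
        intro t
        rw [E.sum _ fun t' _ => hVB t t']
        have : ∀ t', (E fun k => V k t t') ≤ (if t = t' then B * B else 0) + ε ^ 2 / 2 := by
          intro t'
          split_ifs with h
          · have := (le_abs_self _).trans (E.absle fun k => hVb k t t')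
            have : 0 < ε ^ 2 / 2 := by positivity
            linarith
          · simpa using h5 t t' h
        refine (Finset.sum_le_sum fun t' _ => this t').trans ?_
        rw [Finset.sum_add_distrib]; simp
      have c4 := Finset.sum_le_sum fun (t : Fin H) (_ : t ∈ Finset.univ) => c3 t
      simp only [Finset.sum_const, Finset.card_univ, Fintype.card_fin, nsmul_eq_mul] at c4
      refine (mul_le_mul_of_nonneg_left c4 (by positivity)).trans ?_
      rw [div_lt_iff₀ (by positivity)] at hH
      have : (1 / (H : ℝ)) ^ 2 * (H * (B * B + H * (ε ^ 2 / 2))) = B * B / H + ε ^ 2 / 2 := by field_simp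
      rw [this]
      have : B * B / H ≤ ε ^ 2 / 2 := by rw [div_le_iff₀ hHr]; nlinarith
      linarith
    exact abs_le_of_sq_le_sq h6 hε.le
end SZ

namespace SZ
open Topology

def Dv (X : ℕ) (Q : ℤ) : Prop := 2 ≤ Q ∧ ∀ t : ℤ, 1 ≤ t → t ≤ X → t ∣ Q

theorem Dv.mono {X X' : ℕ} {Q : ℤ} (h : Dv X Q) (hX : X' ≤ X) : Dv X' Q :=
  ⟨h.1, fun t h1 h2 => h.2 t h1 (h2.trans (by exact_mod_cast hX))⟩

theorem E_periodic {φ : ℤ → ℝ} (hφ : Bdd φ) {b m : ℤ} (hb : b ≠ 0) (hc : IsCoprime b m)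
    (hper : ∀ c l, φ (l + c * b) = φ l) : (E fun h => φ (m * h)) = E φ := by
  obtain ⟨n, hn⟩ : ∃ n : ℕ, n = b.natAbs := ⟨_, rfl⟩
  have hn0 : n ≠ 0 := by rw [hn]; exact Int.natAbs_ne_zero.2 hb
  have : NeZero n := ⟨hn0⟩
  let Ψ : ZMod n → ℝ := fun z => φ z.val
  have hΨ : ∀ l : ℤ, φ l = Ψ (l : ZMod n) := by
    intro l
    simp only [Ψ]
    have h1 : ((((l : ZMod n).val : ℕ) : ℤ) : ZMod n) = (l : ZMod n) := by simp
    rw [ZMod.intCast_eq_intCast_iff_dvd_sub] at h1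
    have h2 : b ∣ l - ((l : ZMod n).val : ℤ) := by
      rw [← Int.natAbs_dvd, ← hn]; exact h1
    obtain ⟨c, hc⟩ := h2
    rw [← hper c ((l : ZMod n).val : ℤ)]; congr 1; rw [mul_comm c b, ← hc]; ring
  have hnr : (n : ℝ) ≠ 0 := by exact_mod_cast hn0
  have hu : IsUnit (m : ZMod n) := by
    obtain ⟨u, v, huv⟩ := hc
    have hb0 : (b : ZMod n) = 0 := by
      rw [ZMod.intCast_zmod_eq_zero_iff_dvd, hn]; exact Int.natAbs_dvd.2 dvd_rfl
    have := congrArg (Int.cast : ℤ → ZMod n) huv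
    push_cast at this
    rw [hb0, mul_zero, zero_add] at this
    exact IsUnit.of_mul_eq_one _ ((mul_comm _ _).trans this)
  have gen : ∀ ψ : ℤ → ℝ, Bdd ψ → (∀ l : ℤ, ∑ z : ZMod n, ψ (l + z.val) = ∑ z, Ψ z) → E ψ = (∑ z, Ψ z) / n := by
    intro ψ hψ h
    have e1 : (E fun l => ∑ z : ZMod n, ψ (l + z.val)) = n * E ψ := by
      rw [E.sum _ fun z _ => hψ.comp _]
      simp [E_shift hψ, ZMod.card]
    simp only [h, Mean.const] at e1
    rw [e1]; field_simp
  have g1 := gen φ hφ (fun l => by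
    simp only [hΨ]
    push_cast
    simp only [ZMod.natCast_val, ZMod.cast_id', id_eq]
    exact Equiv.sum_comp (Equiv.addLeft (l : ZMod n)) Ψ)
  have g2 := gen (fun h => φ (m * h)) (hφ.comp _) (fun l => by
    simp only [hΨ]
    push_cast
    simp only [ZMod.natCast_val, ZMod.cast_id', id_eq]
    obtain ⟨u, hu⟩ := hu
    rw [← hu]
    exact Equiv.sum_comp ((Equiv.addLeft (l : ZMod n)).trans u.mulLeft) Ψ)
  rw [g1, g2]

theorem baseFam (X : ℕ) (Q : ℤ) (hQ : Dv X Q) :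
    Fam ℤ (fun a l => l + a) (fun k φ => (E fun h => φ ((1 + Q * k) * h)) - E φ) (fun k => 1 + Q * k) (1 + 1) 1 X := by
  have act : ∀ a p : ℤ, p + -a + a = p := fun a p => by ring
  have blin : ∀ k : ℤ, BLin (fun φ : ℤ → ℝ => (E fun h => φ ((1 + Q * k) * h)) - E φ) (1 + 1) := fun k => by
    have h1 : BLin (fun φ : ℤ → ℝ => E fun h => φ ((1 + Q * k) * h)) 1 :=
      Mean.blin (E.map fun h => (1 + Q * k) * h)
    exact BLin.sub (M := fun φ : ℤ → ℝ => E fun h => φ ((1 + Q * k) * h)) (M' := fun φ => E φ) h1 (Mean.blin E)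
  have ne : ∀ k, 1 + Q * k ≠ 0 := fun k h => by
    have h1 := hQ.1
    have : Q ∣ 1 := ⟨-k, by linarith⟩
    have := Int.le_of_dvd one_pos this
    omega
  have cop : ∀ k t : ℤ, ((1 : ℕ) : ℤ) ≤ t → t ≤ X → IsCoprime (1 + Q * k) (1 + Q * (k + t)) := fun k t h1 h2 => by
    have h1 : (1 : ℤ) ≤ t := by exact_mod_cast h1
    obtain ⟨w, hw⟩ := hQ.2 t h1 h2
    have hc : IsCoprime (1 + Q * k) Q := ⟨1, -k, by ring⟩
    have hc2 : IsCoprime (1 + Q * k) t := IsCoprime.of_mul_right_left (z := w) (hw ▸ hc)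
    have e : 1 + Q * (k + t) = Q * t + (1 + Q * k) * 1 := by ring
    rw [e]
    exact (hc.mul_right hc2).add_mul_left_right 1
  have inv : ∀ (k a : ℤ) (φ : ℤ → ℝ), Bdd φ → (E fun h => φ ((1 + Q * k) * h + a * (1 + Q * k))) -
      (E fun l => φ (l + a * (1 + Q * k))) = (E fun h => φ ((1 + Q * k) * h)) - E φ := fun k a φ hφ => by
    rw [E_shift hφ]
    congr 1
    rw [← E_shift (a := fun h => φ ((1 + Q * k) * h)) (hφ.comp _) a]
    congr 1; ext h; congr 1; ring
  exact { act := act, blin := blin, ne := ne, cop := cop, inv := inv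
          kill := fun k b φ hφ hb hc hper => by rw [E_periodic hφ hb hc hper, sub_self] }

theorem Dstar (I : Type) [Fintype I] (ε : ℝ) (hε : 0 < ε) : ∃ X : ℕ, ∀ Q : ℤ, Dv X Q →
    ∀ (G Y : Type) [AddCommGroup G] (S : Sys G Y) (F : I → Y → ℝ), (∀ i x, |F i x| ≤ 1) →
    ∀ (R : I → G) (W : G),
    |(E fun h => E fun k => S.μ fun x => (∏ i, F i (S.act ((1 + Q * k) • R i) x)) *
        ∏ i, F i (S.act ((1 + Q * k) • R i + ((1 + Q * k) * h) • W) x)) -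
      E fun k => E fun l => S.μ fun x => (∏ i, F i (S.act ((1 + Q * k) • R i) x)) *
        ∏ i, F i (S.act ((1 + Q * k) • R i + l • W) x)| ≤ ε := by
  obtain ⟨X, hX⟩ := RT (Fintype.card I) ε hε (1 + 1) (by norm_num) 1 le_rfl
  refine ⟨X, fun Q hQ G Y _ S F hF R W => ?_⟩
  have hsw := swap_bil S (fun i x => F i (S.act (R i) x)) (fun i x => hF _ _) (fun i => Q • R i) (fun i => 0)
    (fun i x => F i (S.act (R i) x)) (fun i x => hF _ _) (fun i => Q • R i) (fun i => W) (Q • W)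
  simp only [E12_apply, E21_apply, ← S.add] at hsw
  have e1 : ∀ (k h : ℤ) i, R i + (k • Q • R i + h • (0 : G)) = (1 + Q * k) • R i := fun k h i => by module
  have e2 : ∀ (k h : ℤ) i, R i + (k • Q • R i + h • W + (k * h) • Q • W) =
    (1 + Q * k) • R i + ((1 + Q * k) * h) • W := fun k h i => by module
  simp only [e1, e2] at hsw
  rw [hsw]
  let e := Fintype.equivFin I
  have hr := hX ℤ _ _ _ (baseFam X Q hQ) 1 Q G Y S (fun i => F (e.symm i)) (fun i => hF _) (fun i => R (e.symm i)) W
    (fun k l x => ∏ i, F i (S.act ((1 + Q * k) • R i + l • W) x)) (fun k l x => prod_abs_le _ fun i => hF _ _)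
    (fun k a p x => by simp only [← S.add]; congr 1; ext i; congr 2; module)
  have h : ∀ (k : ℤ) x, ∏ i, F (e.symm i) (S.act ((1 + Q * k) • R (e.symm i)) x)
    = ∏ i, F i (S.act ((1 + Q * k) • R i) x) := fun k x =>
      Equiv.prod_comp e.symm (fun i => F i (S.act ((1 + Q * k) • R i) x))
  simp only [h] at hr
  have hb : ∀ (A : ℤ → ℤ → ℤ), Bdd fun k => E fun l => S.μ fun x => (∏ i, F i (S.act ((1 + Q * k) • R i) x)) *
        ∏ i, F i (S.act ((1 + Q * k) • R i + (A k l) • W) x) := fun A =>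
    ⟨1, fun k => E.absle fun l => S.μ.absle fun x =>
      mul_abs_le (prod_abs_le _ fun i => hF _ _) (prod_abs_le _ fun i => hF _ _)⟩
  rw [E.sub (hb fun k l => (1 + Q * k) * l) (hb fun k l => l)] at hr
  exact hr
end SZ

namespace SZ
open Topology

/-- System with an extra integer coordinate. -/
noncomputable def Sys.zz {G Y : Type} [AddCommGroup G] (S : Sys G Y) : Sys (G × ℤ) (Y × ℤ) where
  act g x := (S.act g.1 x.1, x.2 + g.2)
  zero x := by simp [S.zero]
  add a b x := by simp [S.add]; ring
  μ := S.μ.prod E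
  inv g f hf := by
    simp only [Mean.prod_apply]
    rw [← E_shift (a := fun l => S.μ fun x => f (x, l)) (by
      simpa using Mean.bdd S.μ (hf.comp fun q : ℤ × Y => (q.2, q.1))) g.2]
    congr 1; ext p
    exact S.inv g.1 (fun x => f (x, p + g.2)) (hf.comp _)

def Xi {G Y ι : Type} [AddCommGroup G] [Fintype ι] (S : Sys G Y) {ℓ : ℕ} (T : Fin ℓ → G) (R : Fin ℓ → ι → G)
    (F : Fin ℓ → ι → Y → ℝ) (m s : ℤ) (x : Y) : ℝ := ∏ j, ∏ i, F j i (S.act (s • T j + m • R j i) x)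

theorem Xi_le {G Y ι : Type} [AddCommGroup G] [Fintype ι] (S : Sys G Y) {ℓ : ℕ} (T : Fin ℓ → G) (R : Fin ℓ → ι → G)
    {F : Fin ℓ → ι → Y → ℝ} (hF : ∀ j i x, |F j i x| ≤ 1) (m s : ℤ) (x : Y) : |Xi S T R F m s x| ≤ 1 :=
  prod_abs_le _ fun j => prod_abs_le _ fun i => hF _ _ _

def Corr (ℓ : ℕ) : Prop := ∀ (ι : Type) [Fintype ι] (ε : ℝ), 0 < ε → ∃ X : ℕ, ∀ Q : ℤ, Dv X Q →
    ∀ (G Y : Type) [AddCommGroup G] (S : Sys G Y) (T : Fin (ℓ + 1) → G) (R : Fin (ℓ + 1) → ι → G)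
    (F : Fin (ℓ + 1) → ι → Y → ℝ), (∀ j i x, |F j i x| ≤ 1) → ∀ c : ℤ → ℤ,
    |(E fun n => E fun k => S.μ (Xi S T R F (1 + Q * k) (c k + (1 + Q * k) * n))) -
      E fun k => E fun l => S.μ (Xi S T R F (1 + Q * k) l)| ≤ ε

theorem corr_zero : Corr 0 := by
  intro ι _ ε hε
  refine ⟨0, fun Q hQ G Y _ S T R F hF c => ?_⟩
  have h : ∀ m s, S.μ (Xi S T R F m s) = S.μ (Xi S T R F m 0) := by
    intro m s
    rw [← S.inv (s • T 0) _ ⟨1, Xi_le S T R hF m 0⟩]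
    congr 1; ext x
    simp only [Xi, Fin.prod_univ_succ, Finset.univ_eq_empty, Finset.prod_empty, ← S.add]
    congr 1
    refine Finset.prod_congr rfl fun i _ => ?_
    congr 2; module
  simp only [fun k n => h (1 + Q * k) (c k + (1 + Q * k) * n), fun k l => h (1 + Q * k) l, Mean.const, sub_self,
    abs_zero, hε.le]

/-- van der Corput type inequality. -/
theorem vdC {Y : Type} (ν : Mean Y) {u : ℤ → Y → ℝ} (hu : ∀ n x, |u n x| ≤ 1) {g : Y → ℝ} (hg : Bdd g) :
    (E fun n => ν fun x => g x * u n x) ^ 2 ≤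
      (E fun h => E fun n => ν fun x => u n x * u (n + h) x) * ν fun x => g x * g x := by
  have hub : ∀ n, Bdd (u n) := fun n => ⟨1, hu n⟩
  have hR := RR (ν.prod E) (Mean.blin E) zero_le_one (Ξ := fun h (y : Y × ℤ) => u (y.2 + h) y.1)
    (fun h y => hu _ _) (g := fun y => g y.1) (hg.comp _)
  simp only [Mean.prod_apply, Mean.const] at hR
  have b1 : Bdd fun n => ν fun x => g x * u n x := by
    obtain ⟨C, hC⟩ := hg
    refine ⟨C, fun n => ν.absle fun x => ?_⟩
    rw [abs_mul]
    exact (mul_le_of_le_one_right (abs_nonneg _) (hu _ _)).trans (hC x)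
  have e1 : (E fun h => E fun n => ν fun x => g x * u (n + h) x) = E fun n => ν fun x => g x * u n x := by
    have : ∀ h, (E fun n => ν fun x => g x * u (n + h) x) = E fun n => ν fun x => g x * u n x := fun h =>
      E_shift (a := fun n => ν fun x => g x * u n x) b1 h
    simp [this]
  rw [e1] at hR
  refine hR.trans (le_of_eq ?_)
  congr 1
  have b2 : ∀ h, Bdd fun n => ν fun x => u n x * u (n + h) x := fun h =>
    ⟨1, fun n => ν.absle fun x => mul_abs_le (hu _ _) (hu _ _)⟩
  have b3 : Bdd fun h => E fun n => ν fun x => u n x * u (n + h) x :=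
    ⟨1, fun h => E.absle fun n => ν.absle fun x => mul_abs_le (hu _ _) (hu _ _)⟩
  have e2 : ∀ q h : ℤ, (E fun n => ν fun x => u (n + q) x * u (n + h) x) =
      E fun n => ν fun x => u n x * u (n + (h + -q)) x := fun q h => by
    rw [← E_shift (b2 (h + -q)) q]
    congr 1; ext n; congr 1; ext x; congr 2; ring
  simp only [e2]
  have e3 : ∀ q, (E fun h => E fun n => ν fun x => u n x * u (n + (h + -q)) x) =
    E fun h => E fun n => ν fun x => u n x * u (n + h) x := fun q => E_shift b3 (-q)
  simp [e3]

theorem corr_succ {ℓ : ℕ} (ih : Corr ℓ) : Corr (ℓ + 1) := by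
  intro ι _ ε hε
  have hε1 : 0 < ε ^ 2 / 4 := by positivity
  obtain ⟨X1, hX1⟩ := ih (ι ⊕ ι) (ε ^ 2 / 4) hε1
  obtain ⟨X2, hX2⟩ := Dstar (Fin (ℓ + 1) × ι) (ε ^ 2 / 4) hε1
  refine ⟨max X1 X2, fun Q hQ G Y _ S T R F hF c => ?_⟩
  have hQ1 := hQ.mono (le_max_left X1 X2)
  have hQ2 := hQ.mono (le_max_right X1 X2)
  let T' : Fin (ℓ + 1) → G := fun j => T j.succ - T 0
  let R' : Fin (ℓ + 1) → ι → G := fun j => R j.succ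
  let F' : Fin (ℓ + 1) → ι → Y → ℝ := fun j => F j.succ
  have hF' : ∀ j i x, |F' j i x| ≤ 1 := fun j => hF _
  let m : ℤ → ℤ := fun k => 1 + Q * k
  let Ξ : ℤ → ℤ → Y → ℝ := Xi S T' R' F'
  have hΞ : ∀ m s x, |Ξ m s x| ≤ 1 := Xi_le S T' R' hF'
  have hΞΞ : ∀ m s m' s' , |S.μ fun x => Ξ m s x * Ξ m' s' x| ≤ 1 := fun m s m' s' =>
    S.μ.absle fun x => mul_abs_le (hΞ _ _ _) (hΞ _ _ _)
  let g : Y × ℤ → ℝ := fun y => ∏ i, F 0 i (S.act (m y.2 • R 0 i) y.1)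
  have hg1 : ∀ y, |g y| ≤ 1 := fun y => prod_abs_le _ fun i => hF _ _ _
  have hg : Bdd g := ⟨1, hg1⟩
  have hφ : ∀ k s, S.μ (Xi S T R F (m k) s) = S.μ fun x => g (x, k) * Ξ (m k) s x := by
    intro k s
    rw [← S.inv (s • T 0) (fun x => g (x, k) * Ξ (m k) s x) ⟨1, fun x => mul_abs_le (hg1 _) (hΞ _ _ _)⟩]
    congr 1; ext x
    rw [Xi, Fin.prod_univ_succ]
    simp only [g, Ξ, Xi, ← S.add, R', F', T']
    congr 1
    · refine Finset.prod_congr rfl fun i _ => ?_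
      congr 2; abel
    · refine Finset.prod_congr rfl fun j _ => Finset.prod_congr rfl fun i _ => ?_
      congr 2; rw [smul_sub]; abel
  let ν : Mean (Y × ℤ) := S.μ.prod E
  let u : ℤ → Y × ℤ → ℝ := fun n y => Ξ (m y.2) (c y.2 + m y.2 * n) y.1
  have hu : ∀ n y, |u n y| ≤ 1 := fun n y => hΞ _ _ _
  let L' : (Y × ℤ → ℝ) → ℝ := fun g => E fun k => E fun l => S.μ fun x => g (x, k) * Ξ (m k) l x
  -- the target in terms of the two functionals
  have ht1 : (E fun n => E fun k => S.μ (Xi S T R F (1 + Q * k) (c k + (1 + Q * k) * n))) =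
      E fun n => ν fun y => g y * u n y := by
    congr 1; ext n
    simp only [ν, Mean.prod_apply]
    congr 1; ext k
    exact hφ k _
  have ht2 : (E fun k => E fun l => S.μ (Xi S T R F (1 + Q * k) l)) = L' g := by
    simp only [L']
    congr 1; ext k; congr 1; ext l; exact hφ k l
  rw [ht1, ht2]
  -- bounds
  have hLk : ∀ k (g : Y → ℝ), Bdd g → (E fun l => S.μ fun x => g x * Ξ (m k) l x) ^ 2 ≤
      (E fun l' => E fun l => S.μ fun x => Ξ (m k) l' x * Ξ (m k) (l' + l) x) * S.μ fun x => g x * g x := by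
    intro k g hg
    have := RR S.μ (Mean.blin E) zero_le_one (Ξ := fun l => Ξ (m k) l) (fun l x => hΞ _ _ _) hg
    refine this.trans (le_of_eq ?_)
    congr 2; ext l'
    rw [← E_shift (a := fun l => S.μ fun x => Ξ (m k) l' x * Ξ (m k) l x) ⟨1, fun l => hΞΞ _ _ _ _⟩ l']
    congr 1; ext l; congr 1; ext x; rw [add_comm l l']
  let XX : ℝ := E fun k => E fun l' => E fun l => S.μ fun x => Ξ (m k) l' x * Ξ (m k) (l' + l) x
  let V : ℝ := E fun h => E fun n => ν fun y => u n y * u (n + h) y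
  have hgl : ∀ g : Y × ℤ → ℝ, Bdd g → ∃ C, ∀ k l, |S.μ fun x => g (x, k) * Ξ (m k) l x| ≤ C := by
    rintro g ⟨C, hC⟩
    refine ⟨C, fun k l => S.μ.absle fun x => ?_⟩
    rw [abs_mul]
    exact (mul_le_of_le_one_right (abs_nonneg _) (hΞ _ _ _)).trans (hC _)
  have hL'lin : Lin L' := by
    constructor
    · intro a b ha hb
      obtain ⟨C, hC⟩ := hgl a ha
      obtain ⟨C', hC'⟩ := hgl b hb
      simp only [L']
      rw [← E.add ⟨C, fun k => E.absle (hC k)⟩ ⟨C', fun k => E.absle (hC' k)⟩]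
      congr 1; ext k
      rw [← E.add ⟨C, hC k⟩ ⟨C', hC' k⟩]
      congr 1; ext l
      rw [← S.μ.add ((ha.comp _).mul ⟨1, hΞ _ _⟩) ((hb.comp _).mul ⟨1, hΞ _ _⟩)]
      congr 1; ext x; ring
    · intro r a ha
      obtain ⟨C, hC⟩ := hgl a ha
      simp only [L']
      rw [← E.smul _ ⟨C, fun k => E.absle (hC k)⟩]
      congr 1; ext k
      rw [← E.smul _ ⟨C, hC k⟩]
      congr 1; ext l
      rw [← S.μ.smul _ ((ha.comp _).mul ⟨1, hΞ _ _⟩)]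
      congr 1; ext x; ring
  have hV : ∀ g, Bdd g → (E fun n => ν fun y => g y * u n y) ^ 2 ≤ V * ν fun y => g y * g y :=
    fun g hg => vdC ν hu hg
  have hXX : ∀ g, Bdd g → (L' g) ^ 2 ≤ XX * ν fun y => g y * g y := by
    intro g hg
    have hXk0 : ∀ k, 0 ≤ E fun l' => E fun l => S.μ fun x => Ξ (m k) l' x * Ξ (m k) (l' + l) x := fun k => by
      have := (sq_nonneg _).trans (hLk k (fun _ => 1) (by simp))
      simpa using this
    set Xk : ℤ → ℝ := fun k => E fun l' => E fun l => S.μ fun x => Ξ (m k) l' x * Ξ (m k) (l' + l) x with hXk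
    have hXkb : Bdd Xk := ⟨1, fun k => E.absle fun l' => E.absle fun l => hΞΞ _ _ _ _⟩
    have hgk0 : ∀ k, 0 ≤ S.μ fun x => g (x, k) * g (x, k) := fun k => S.μ.sq_nonneg (a := fun x => g (x, k)) (hg.comp _)
    have hgkb : Bdd fun k => S.μ fun x => g (x, k) * g (x, k) := by
      obtain ⟨C, hC⟩ := hg.mul hg
      exact ⟨C, fun k => S.μ.absle fun x => hC _⟩
    have hsq : ∀ f : ℤ → ℝ, Bdd f → Bdd fun k => √(f k) := by
      rintro f ⟨C, hC⟩
      refine ⟨√C, fun k => ?_⟩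
      rw [abs_of_nonneg (Real.sqrt_nonneg _)]
      exact Real.sqrt_le_sqrt ((le_abs_self _).trans (hC k))
    have hLkb : Bdd fun k => E fun l => S.μ fun x => g (x, k) * Ξ (m k) l x := by
      obtain ⟨C, hC⟩ := hgl g hg
      exact ⟨C, fun k => E.absle (hC k)⟩
    have hk : ∀ k, |E fun l => S.μ fun x => g (x, k) * Ξ (m k) l x| ≤ √(Xk k) * √(S.μ fun x => g (x, k) * g (x, k)) := by
      intro k
      rw [← Real.sqrt_mul (hXk0 k)]
      exact Real.abs_le_sqrt (hLk k (fun x => g (x, k)) (hg.comp _))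
    have h1 : |L' g| ≤ E fun k => √(Xk k) * √(S.μ fun x => g (x, k) * g (x, k)) := by
      have hb := (hsq _ hXkb).mul (hsq _ hgkb)
      rw [abs_le]
      constructor
      · have e := E.smul (-1) hb
        have e2 := E.mono ((Bdd.const (-1)).mul hb) hLkb (fun k => by have := (abs_le.1 (hk k)).1; linarith)
        rw [e] at e2
        calc _ = -1 * (E fun k => √(Xk k) * √(S.μ fun x => g (x, k) * g (x, k))) := by ring
          _ ≤ _ := e2
      · exact E.mono hLkb hb fun k => (abs_le.1 (hk k)).2
    have h2 := E.cs_sq (hsq _ hXkb) (hsq _ hgkb)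
    have hXk0' : ∀ k, √(Xk k) * √(Xk k) = Xk k := fun k => Real.mul_self_sqrt (hXk0 k)
    simp only [hXk0', fun k => Real.mul_self_sqrt (hgk0 k)] at h2
    refine le_trans ?_ h2
    rw [← sq_abs (L' g)]
    exact pow_le_pow_left₀ (abs_nonneg _) h1 2
  have hV0 : 0 ≤ V := by
    have := (sq_nonneg _).trans (hV (fun _ => 1) (by simp))
    simpa using this
  have hXX0 : 0 ≤ XX := by
    have := (sq_nonneg _).trans (hXX (fun _ => 1) (by simp))
    simpa using this
  have hP := PairBd ν (Mean.blin E) zero_le_one hu hL'lin hV0 hXX0 hV hXX hg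
  -- (i)
  have hi : |(E fun n => L' (u n)) - XX| ≤ ε ^ 2 / 4 := by
    have := hX1 Q hQ1 (ℤ → G) (Y × ℤ) (S.pr E) (fun j _ => T' j) (fun j => Sum.elim (fun i _ => R' j i) (fun i _ => R' j i))
      (fun j => Sum.elim (fun i y => F' j i y.1) (fun i y => F' j i (S.act (y.2 • T' j) y.1)))
      (by rintro j (i | i) y <;> exact hF' _ _ _) c
    have e : ∀ k s, (S.pr E).μ (Xi (S.pr E) (fun j _ => T' j) (fun j => Sum.elim (fun i _ => R' j i) (fun i _ => R' j i))
      (fun j => Sum.elim (fun i y => F' j i y.1) (fun i y => F' j i (S.act (y.2 • T' j) y.1))) (m k) s) =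
        E fun l => S.μ fun x => Ξ (m k) s x * Ξ (m k) (s + l) x := by
      intro k s
      simp only [Sys.pr, Mean.prod_apply]
      congr 1; ext l; congr 1; ext x
      simp only [Xi, Ξ, Fintype.prod_sum_type, Sum.elim_inl, Sum.elim_inr, Finset.prod_mul_distrib, Pi.add_apply,
        Pi.smul_apply, ← S.add]
      congr 1
      refine Finset.prod_congr rfl fun j _ => Finset.prod_congr rfl fun i _ => ?_
      congr 2; module
    have e2 : (E fun n => L' (u n)) = E fun n => E fun k => E fun l =>
        S.μ fun x => Ξ (m k) (c k + m k * n) x * Ξ (m k) ((c k + m k * n) + l) x := by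
      congr 1; ext n; simp only [L', u]; congr 1; ext k
      rw [← E_shift (a := fun l => S.μ fun x => Ξ (m k) (c k + m k * n) x * Ξ (m k) l x)
        ⟨1, fun l => hΞΞ _ _ _ _⟩ (c k + m k * n)]
      congr 1; ext l; congr 1; ext x; rw [add_comm l]
    rw [e2]
    simp only [show ∀ k, 1 + Q * k = m k from fun k => rfl, e] at this
    exact this
  -- (iii)
  have hiii : V ≤ XX + 2 * (ε ^ 2 / 4) := by
    have s1 : ∀ h, |(E fun n => ν fun y => u n y * u (n + h) y) -
        E fun k => E fun l => S.μ fun x => Ξ (m k) l x * Ξ (m k) (l + m k * h) x| ≤ ε ^ 2 / 4 := by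
      intro h
      have := hX1 Q hQ1 G Y S T' (fun j => Sum.elim (fun i => R' j i) (fun i => R' j i + h • T' j))
        (fun j => Sum.elim (fun i => F' j i) (fun i => F' j i))
        (by rintro j (i | i) y <;> exact hF' _ _ _) c
      have e : ∀ k s, S.μ (Xi S T' (fun j => Sum.elim (fun i => R' j i) (fun i => R' j i + h • T' j))
        (fun j => Sum.elim (fun i => F' j i) (fun i => F' j i)) (m k) s) =
          S.μ fun x => Ξ (m k) s x * Ξ (m k) (s + m k * h) x := by
        intro k s
        congr 1; ext x
        simp only [Xi, Ξ, Fintype.prod_sum_type, Sum.elim_inl, Sum.elim_inr, Finset.prod_mul_distrib]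
        congr 1
        refine Finset.prod_congr rfl fun j _ => Finset.prod_congr rfl fun i _ => ?_
        congr 2; module
      simp only [show ∀ k, 1 + Q * k = m k from fun k => rfl, e] at this
      have e2 : (E fun n => ν fun y => u n y * u (n + h) y) = E fun n => E fun k =>
        S.μ fun x => Ξ (m k) (c k + m k * n) x * Ξ (m k) (c k + m k * n + m k * h) x := by
        congr 1; ext n; simp only [ν, Mean.prod_apply, u]
        congr 1; ext k; congr 1; ext x; congr 2; ring
      rw [e2]; exact this
    have s2 := E.close (a := fun h => E fun n => ν fun y => u n y * u (n + h) y)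
      (b := fun h => E fun k => E fun l => S.μ fun x => Ξ (m k) l x * Ξ (m k) (l + m k * h) x)
      ⟨1, fun h => E.absle fun n => ν.absle fun y => mul_abs_le (hu _ _) (hu _ _)⟩
      ⟨1, fun h => E.absle fun k => E.absle fun l => hΞΞ _ _ _ _⟩ s1
    have s3 := hX2 Q hQ2 (G × ℤ) (Y × ℤ) S.zz (fun i y => F' i.1 i.2 (S.act (y.2 • T' i.1) y.1))
      (fun i y => hF' _ _ _) (fun i => (R' i.1 i.2, 0)) (0, 1)
    have e : ∀ k l', (S.zz.μ fun x => (∏ i : Fin (ℓ + 1) × ι, F' i.1 i.2 (S.act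
          ((S.zz.act (m k • (R' i.1 i.2, 0)) x).2 • T' i.1) (S.zz.act (m k • (R' i.1 i.2, 0)) x).1)) *
        ∏ i : Fin (ℓ + 1) × ι, F' i.1 i.2 (S.act
          ((S.zz.act (m k • (R' i.1 i.2, 0) + l' • (0, 1)) x).2 • T' i.1)
            (S.zz.act (m k • (R' i.1 i.2, 0) + l' • (0, 1)) x).1)) =
        E fun l => S.μ fun x => Ξ (m k) l x * Ξ (m k) (l + l') x := by
      intro k l'
      simp only [Sys.zz, Mean.prod_apply]
      congr 1; ext l; congr 1; ext x
      simp only [Xi, Ξ, Fintype.prod_prod_type, ← S.add]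
      simp
    simp only [show ∀ k, 1 + Q * k = m k from fun k => rfl, e] at s3
    have s4 : (E fun k => E fun l' => E fun l => S.μ fun x => Ξ (m k) l x * Ξ (m k) (l + l') x) = XX := by
      congr 1; ext k
      have := swap_lin S (I := (Fin (ℓ + 1) × ι) ⊕ (Fin (ℓ + 1) × ι))
        (Sum.elim (fun i x => F' i.1 i.2 (S.act (m k • R' i.1 i.2) x)) (fun i x => F' i.1 i.2 (S.act (m k • R' i.1 i.2) x)))
        (by rintro (i | i) x <;> exact hF' _ _ _) (Sum.elim (fun i => T' i.1) (fun i => T' i.1))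
        (Sum.elim (fun i => 0) (fun i => T' i.1))
      have e : ∀ l l' : ℤ, (S.μ fun x => ∏ i, (Sum.elim (fun i x => F' i.1 i.2 (S.act (m k • R' i.1 i.2) x))
          (fun i x => F' i.1 i.2 (S.act (m k • R' i.1 i.2) x)) : (Fin (ℓ + 1) × ι) ⊕ (Fin (ℓ + 1) × ι) → Y → ℝ) i
          (S.act (l • (Sum.elim (fun i => T' i.1) (fun i => T' i.1) : (Fin (ℓ + 1) × ι) ⊕ (Fin (ℓ + 1) × ι) → G) i +
            l' • (Sum.elim (fun i => 0) (fun i => T' i.1) : (Fin (ℓ + 1) × ι) ⊕ (Fin (ℓ + 1) × ι) → G) i) x)) =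
          S.μ fun x => Ξ (m k) l x * Ξ (m k) (l + l') x := by
        intro l l'
        congr 1; ext x
        simp only [Xi, Ξ, Fintype.prod_sum_type, Sum.elim_inl, Sum.elim_inr, Fintype.prod_prod_type, ← S.add]
        congr 1
        · refine Finset.prod_congr rfl fun j _ => Finset.prod_congr rfl fun i _ => ?_
          congr 2; module
        · refine Finset.prod_congr rfl fun j _ => Finset.prod_congr rfl fun i _ => ?_
          congr 2; module
      simp only [E12_apply, E21_apply, e] at this
      exact this
    rw [s4] at s3
    have := (abs_le.1 s2).2
    have := (abs_le.1 s3).2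
    simp only [V]
    linarith
  have hg2 : (ν fun y => g y * g y) ≤ 1 := (le_abs_self _).trans (ν.absle fun y => mul_abs_le (hg1 _) (hg1 _))
  have hg0 : 0 ≤ ν fun y => g y * g y := ν.sq_nonneg hg
  have hc : V + XX - 2 * (E fun n => L' (u n)) ≤ ε ^ 2 := by
    have := (abs_le.1 hi).1
    linarith
  refine abs_le_of_sq_le_sq (hP.trans ?_) hε.le
  calc _ ≤ ε ^ 2 * (ν fun y => g y * g y) := mul_le_mul_of_nonneg_right hc hg0
    _ ≤ ε ^ 2 := mul_le_of_le_one_right (by positivity) hg2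

theorem corr (ℓ : ℕ) : Corr ℓ := by
  induction ℓ with
  | zero => exact corr_zero
  | succ ℓ ih => exact corr_succ ih
end SZ

namespace SZ
open Topology

/-- Indicator of a proposition. -/
noncomputable def ind (P : Prop) : ℝ := open Classical in if P then 1 else 0

theorem ind_t {P : Prop} (h : P) : ind P = 1 := by simp [ind, h]
theorem ind_f {P : Prop} (h : ¬ P) : ind P = 0 := by simp [ind, h]
theorem ind_nn (P : Prop) : 0 ≤ ind P := by unfold ind; split_ifs <;> norm_num
theorem ind_le (P : Prop) : ind P ≤ 1 := by unfold ind; split_ifs <;> norm_num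
theorem ind_mono {P Q : Prop} (h : P → Q) : ind P ≤ ind Q := by
  by_cases hP : P
  · rw [ind_t hP, ind_t (h hP)]
  · rw [ind_f hP]; exact ind_nn _
theorem ind_congr {P Q : Prop} (h : P ↔ Q) : ind P = ind Q := by rw [propext h]

/-- Expectation over a finite type. -/
noncomputable def ex {X : Type} [Finite X] (f : X → ℝ) : ℝ :=
  letI := Fintype.ofFinite X
  (∑ x, f x) / Fintype.card X

theorem ex_eq {X : Type} [Fintype X] (f : X → ℝ) : ex f = (∑ x, f x) / Fintype.card X := by
  unfold ex
  congr!

section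
variable {X Y : Type} [Finite X] [Finite Y]

theorem ex_add (f g : X → ℝ) : (ex fun x => f x + g x) = ex f + ex g := by
  have := Fintype.ofFinite X
  simp only [ex_eq, Finset.sum_add_distrib, add_div]

theorem ex_sub (f g : X → ℝ) : (ex fun x => f x - g x) = ex f - ex g := by
  have := Fintype.ofFinite X
  simp only [ex_eq, Finset.sum_sub_distrib, sub_div]

theorem ex_mul (c : ℝ) (f : X → ℝ) : (ex fun x => c * f x) = c * ex f := by
  have := Fintype.ofFinite X
  simp only [ex_eq, ← Finset.mul_sum, mul_div_assoc]

theorem ex_sum {ι : Type} (s : Finset ι) (f : ι → X → ℝ) : (ex fun x => ∑ i ∈ s, f i x) = ∑ i ∈ s, ex (f i) := by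
  have := Fintype.ofFinite X
  simp only [ex_eq, ← Finset.sum_div]
  rw [Finset.sum_comm]

theorem ex_const [Nonempty X] (c : ℝ) : (ex fun _ : X => c) = c := by
  have := Fintype.ofFinite X
  simp only [ex_eq, Finset.sum_const, nsmul_eq_mul, Finset.card_univ]
  have : (Fintype.card X : ℝ) ≠ 0 := by exact_mod_cast Fintype.card_ne_zero
  field_simp

theorem ex_mono {f g : X → ℝ} (h : ∀ x, f x ≤ g x) : ex f ≤ ex g := by
  have := Fintype.ofFinite X
  simp only [ex_eq]
  gcongr
  exact h _

theorem ex_nn {f : X → ℝ} (h : ∀ x, 0 ≤ f x) : 0 ≤ ex f := by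
  have := Fintype.ofFinite X
  rw [ex_eq]
  exact div_nonneg (Finset.sum_nonneg fun x _ => h x) (Nat.cast_nonneg _)

theorem ex_le [Nonempty X] {f : X → ℝ} {c : ℝ} (h : ∀ x, f x ≤ c) : ex f ≤ c := by
  rw [← ex_const (X := X) c]; exact ex_mono h

theorem le_ex [Nonempty X] {f : X → ℝ} {c : ℝ} (h : ∀ x, c ≤ f x) : c ≤ ex f := by
  rw [← ex_const (X := X) c]; exact ex_mono h

theorem ex_exists [Nonempty X] {f : X → ℝ} {c : ℝ} (h : c ≤ ex f) : ∃ x, c ≤ f x := by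
  by_contra! hc
  have := Fintype.ofFinite X
  have h2 : ex f < c := by
    rw [ex_eq, div_lt_iff₀ (by exact_mod_cast Fintype.card_pos)]
    calc ∑ x, f x < ∑ x : X, c := Finset.sum_lt_sum_of_nonempty Finset.univ_nonempty fun x _ => hc x
      _ = _ := by simp; ring
  linarith

theorem ex_exists_lt [Nonempty X] {f : X → ℝ} {c : ℝ} (h : c < ex f) : ∃ x, c < f x := by
  by_contra! hc
  exact absurd (ex_le hc) (not_le.2 h)

theorem ex_equiv (e : X ≃ Y) (f : Y → ℝ) : (ex fun x => f (e x)) = ex f := by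
  have := Fintype.ofFinite X
  have := Fintype.ofFinite Y
  simp only [ex_eq, Fintype.card_congr e, e.sum_comp]

theorem ex_prod (f : X × Y → ℝ) : ex f = ex fun x => ex fun y => f (x, y) := by
  have := Fintype.ofFinite X
  have := Fintype.ofFinite Y
  simp only [ex_eq, Fintype.sum_prod_type, Fintype.card_prod, ← Finset.sum_div]
  push_cast
  rw [div_div, mul_comm]

theorem ex_comm (f : X → Y → ℝ) : (ex fun x => ex fun y => f x y) = ex fun y => ex fun x => f x y := by
  rw [← ex_prod (fun p : X × Y => f p.1 p.2), ← ex_prod (fun p : Y × X => f p.2 p.1)]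
  exact (ex_equiv (Equiv.prodComm Y X) _).symm

theorem ex_sumfn {α ι κ : Type} [Finite α] [Finite ι] [Finite κ] (f : (ι ⊕ κ → α) → ℝ) :
    ex f = ex fun x : ι → α => ex fun y : κ → α => f (Sum.elim x y) := by
  rw [← ex_equiv (Equiv.sumArrowEquivProdArrow ι κ α).symm, ex_prod]
  rfl

theorem ex_split {α ι : Type} [Finite α] [Finite ι] (P : ι → Prop) [DecidablePred P] (f : (ι → α) → ℝ) :
    ex f = ex fun y : {c // ¬ P c} → α => ex fun x : {c // P c} → α =>
      f (fun c => if h : P c then x ⟨c, h⟩ else y ⟨c, h⟩) := by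
  rw [ex_comm, ← ex_equiv (Equiv.piEquivPiSubtypeProd P (fun _ => α)).symm, ex_prod]
  rfl

/-- single value bound -/
theorem ex_all_ge [Nonempty X] {f : X → ℝ} {a b : ℝ} (h1 : a ≤ ex f) (h2 : ∀ x, f x ≤ b) (x : X) :
    b - Nat.card X * (b - a) ≤ f x := by
  have := Fintype.ofFinite X
  rw [ex_eq, le_div_iff₀ (by exact_mod_cast Fintype.card_pos)] at h1
  have h3 : b - f x ≤ ∑ y, (b - f y) :=
    Finset.single_le_sum (f := fun y => b - f y) (fun y _ => sub_nonneg.2 (h2 y)) (Finset.mem_univ x)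
  simp only [Finset.sum_sub_distrib, Finset.sum_const, Finset.card_univ, nsmul_eq_mul] at h3
  rw [Nat.card_eq_fintype_card]
  nlinarith

/-- Markov. -/
theorem ex_markov [Nonempty X] {f : X → ℝ} (h1 : ∀ x, f x ≤ 1) {δ : ℝ} (hδ : δ ≤ ex f) (h0 : 0 ≤ δ) :
    δ / 2 ≤ ex fun x => ind (δ / 2 ≤ f x) := by
  have : ex f ≤ ex fun x => ind (δ / 2 ≤ f x) + δ / 2 := by
    refine ex_mono fun x => ?_
    by_cases h : δ / 2 ≤ f x
    · rw [ind_t h]; linarith [h1 x]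
    · rw [ind_f h]; linarith
  rw [ex_add, ex_const] at this
  linarith

/-- Pigeonhole. -/
theorem ex_pigeon {ι : Type} [Finite ι] {f : X → ℝ} {g : ι → X → ℝ} (hg : ∀ i x, 0 ≤ g i x)
    (h : ∀ x, 0 < f x → ∃ i, f x ≤ g i x) {δ : ℝ} (h0 : 0 < δ) (hδ : δ ≤ ex f) :
    ∃ i, δ / Nat.card ι ≤ ex (g i) := by
  have := Fintype.ofFinite ι
  have h1 : ex f ≤ ∑ i, ex (g i) := by
    rw [← ex_sum]
    refine ex_mono fun x => ?_
    by_cases hx : 0 < f x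
    · obtain ⟨i, hi⟩ := h x hx
      exact hi.trans (Finset.single_le_sum (f := fun i => g i x) (fun i _ => hg i x) (Finset.mem_univ i))
    · exact (not_lt.1 hx).trans (Finset.sum_nonneg fun i _ => hg i x)
  by_contra! hc
  rw [Nat.card_eq_fintype_card] at hc
  cases isEmpty_or_nonempty ι
  · simp at h1; linarith
  have : ∑ i, ex (g i) < ∑ i : ι, δ / Fintype.card ι := Finset.sum_lt_sum_of_nonempty Finset.univ_nonempty fun i _ => hc i
  have hp : (0 : ℝ) < Fintype.card ι := by exact_mod_cast Fintype.card_pos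
  simp only [Finset.sum_const, Finset.card_univ, nsmul_eq_mul] at this
  rw [mul_div_cancel₀ _ hp.ne'] at this
  linarith

end

theorem ex_prodfn {Γ ι : Type} [Finite Γ] [Fintype ι] (h : Γ → ℝ) :
    (ex fun J : ι → Γ => ∏ c, h (J c)) = (ex h) ^ Fintype.card ι := by
  classical
  have := Fintype.ofFinite Γ
  rw [ex_eq, ex_eq, div_pow, Fintype.card_fun]
  push_cast
  congr 1
  have := Finset.prod_univ_sum (fun _ : ι => (Finset.univ : Finset Γ)) (fun _ g => h g)
  simp only [Finset.prod_const, Finset.card_univ, Fintype.piFinset_univ] at this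
  exact this.symm

/-- Concentration. -/
theorem conc (Γ : Type) [Finite Γ] (g0 : Γ) (M : ℕ) (ε : ℝ) (hε : 0 < ε) :
    ∃ N : ℕ, ∀ (ι : Type) [Finite ι], N ≤ Nat.card ι →
      (ex fun J : ι → Γ => ind (Nat.card {c // J c = g0} < M)) ≤ ε := by
  classical
  have := Fintype.ofFinite Γ
  have : Nonempty Γ := ⟨g0⟩
  set h : Γ → ℝ := fun g => if g = g0 then 1 / 2 else 1 with hh
  have hp : (0 : ℝ) < Fintype.card Γ := by exact_mod_cast Fintype.card_pos
  have h0 : 0 ≤ ex h := ex_nn fun g => by simp only [hh]; split_ifs <;> norm_num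
  have h1 : ex h < 1 := by
    rw [ex_eq, div_lt_one hp]
    calc ∑ x, h x < ∑ x : Γ, (1 : ℝ) := by
          refine Finset.sum_lt_sum (fun i _ => ?_) ⟨g0, Finset.mem_univ _, ?_⟩
          · simp only [hh]; split_ifs <;> norm_num
          · simp only [hh]; norm_num
      _ = _ := by simp
  obtain ⟨N, hN⟩ := exists_pow_lt_of_lt_one (div_pos hε (pow_pos two_pos M) : (0 : ℝ) < ε / 2 ^ M) h1
  refine ⟨N, fun ι _ hι => ?_⟩
  have := Fintype.ofFinite ι
  rw [Nat.card_eq_fintype_card] at hι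
  calc (ex fun J : ι → Γ => ind (Nat.card {c // J c = g0} < M)) ≤ ex fun J : ι → Γ => 2 ^ M * ∏ c, h (J c) := by
        refine ex_mono fun J => ?_
        have e : ∏ c, h (J c) = (1 / 2) ^ (Nat.card {c // J c = g0}) := by
          simp only [hh, Finset.prod_ite, Finset.prod_const, one_pow, mul_one]
          rw [Nat.card_eq_fintype_card, Fintype.card_subtype]
        rw [e]
        by_cases hc : Nat.card {c // J c = g0} < M
        · rw [ind_t hc, one_div, inv_pow, ← div_eq_mul_inv, le_div_iff₀ (by positivity), one_mul]
          exact pow_le_pow_right₀ one_le_two hc.le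
        · rw [ind_f hc]; positivity
    _ = 2 ^ M * (ex h) ^ Fintype.card ι := by rw [ex_mul, ex_prodfn]
    _ ≤ 2 ^ M * (ex h) ^ N := by
        gcongr 2 ^ M * ?_
        exact pow_le_pow_of_le_one h0 h1.le hι
    _ ≤ ε := by
        rw [lt_div_iff₀ (by positivity)] at hN
        linarith

end SZ

namespace SZ
open Topology

/-- A combinatorial subspace with parameter set `κ`. -/
structure Pat (α κ ι : Type) where
  f : ι → α ⊕ κ
  surj : ∀ c, ∃ i, f i = Sum.inr c

namespace Pat
variable {α κ ξ ι ι' : Type}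

def ev (p : Pat α κ ι) (x : κ → α) : ι → α := fun i => Sum.elim id x (p.f i)

theorem ev_inj (p : Pat α κ ι) : Function.Injective p.ev := by
  intro x y h
  ext c
  obtain ⟨i, hi⟩ := p.surj c
  have := congrFun h i
  simpa [ev, hi] using this

def comp (p : Pat α κ ι) (q : Pat α ξ κ) : Pat α ξ ι where
  f i := Sum.elim Sum.inl q.f (p.f i)
  surj c := by
    obtain ⟨j, hj⟩ := q.surj c
    obtain ⟨i, hi⟩ := p.surj j
    exact ⟨i, by simp [hi, hj]⟩

theorem ev_comp (p : Pat α κ ι) (q : Pat α ξ κ) (x : ξ → α) : (p.comp q).ev x = p.ev (q.ev x) := by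
  ext i
  simp only [ev, comp]
  cases p.f i <;> simp [ev]

def right (z : ι → α) (q : Pat α κ ι') : Pat α κ (ι ⊕ ι') where
  f := Sum.elim (fun i => Sum.inl (z i)) q.f
  surj c := by
    obtain ⟨i, hi⟩ := q.surj c
    exact ⟨Sum.inr i, hi⟩

theorem ev_right (z : ι → α) (q : Pat α κ ι') (x : κ → α) : (right z q).ev x = Sum.elim z (q.ev x) := by
  ext i; cases i <;> simp [ev, right]

def left (q : Pat α κ ι) (z : ι' → α) : Pat α κ (ι ⊕ ι') where
  f := Sum.elim q.f (fun i => Sum.inl (z i))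
  surj c := by
    obtain ⟨i, hi⟩ := q.surj c
    exact ⟨Sum.inl i, hi⟩

theorem ev_left (q : Pat α κ ι) (z : ι' → α) (x : κ → α) : (left q z).ev x = Sum.elim (q.ev x) z := by
  ext i; cases i <;> simp [ev, left]

def sum (p : Pat α κ ι) (q : Pat α ξ ι') : Pat α (κ ⊕ ξ) (ι ⊕ ι') where
  f := Sum.elim (fun i => Sum.map id Sum.inl (p.f i)) (fun i => Sum.map id Sum.inr (q.f i))
  surj c := by
    rcases c with c | c
    · obtain ⟨i, hi⟩ := p.surj c
      exact ⟨Sum.inl i, by simp [hi]⟩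
    · obtain ⟨i, hi⟩ := q.surj c
      exact ⟨Sum.inr i, by simp [hi]⟩

theorem ev_sum (p : Pat α κ ι) (q : Pat α ξ ι') (x : κ ⊕ ξ → α) :
    (sum p q).ev x = Sum.elim (p.ev (x ∘ Sum.inl)) (q.ev (x ∘ Sum.inr)) := by
  ext i
  rcases i with i | i
  · simp only [ev, sum, Sum.elim_inl]; cases p.f i <;> simp
  · simp only [ev, sum, Sum.elim_inr]; cases q.f i <;> simp

/-- relabel parameters and coordinates -/
def re (e : ι ≃ κ) : Pat α κ ι where
  f i := Sum.inr (e i)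
  surj c := ⟨e.symm c, by simp⟩

theorem ev_re (e : ι ≃ κ) (x : κ → α) : (re e : Pat α κ ι).ev x = x ∘ e := by
  ext i; simp [ev, re]

instance [Finite α] [Finite κ] [Finite ι] : Finite (Pat α κ ι) :=
  Finite.of_injective (fun p : Pat α κ ι => p.f) (by rintro ⟨f, _⟩ ⟨g, _⟩ h; simpa using h)

end Pat

noncomputable def dens {X : Type} [Finite X] (A : Set X) : ℝ := ex fun x => ind (x ∈ A)

/-- Every set of density at least `δ` contains a `κ`-subspace. -/
def MD (α κ : Type) [Finite α] (δ : ℝ) (ι : Type) [Finite ι] : Prop :=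
  ∀ A : Set (ι → α), δ ≤ dens A → ∃ p : Pat α κ ι, ∀ x, p.ev x ∈ A

theorem MD.mono {α κ ι : Type} [Finite α] [Finite ι] {δ δ' : ℝ} (h : MD α κ δ ι) (hd : δ ≤ δ') : MD α κ δ' ι :=
  fun A hA => h A (hd.trans hA)

theorem MD.equiv {α κ ι ι' : Type} [Finite α] [Finite ι] [Finite ι'] {δ : ℝ} (e : ι ≃ ι') (h : MD α κ δ ι) :
    MD α κ δ ι' := by
  intro A hA
  obtain ⟨p, hp⟩ := h {x | x ∘ e.symm ∈ A} (by
    refine hA.trans (le_of_eq ?_)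
    unfold dens
    rw [← ex_equiv (Equiv.arrowCongr e (Equiv.refl α))]
    rfl)
  refine ⟨(Pat.re e.symm).comp p, fun x => ?_⟩
  rw [Pat.ev_comp, Pat.ev_re]
  exact hp x

theorem MD.params {α κ κ' ι : Type} [Finite α] [Finite ι] {δ : ℝ} (e : κ ≃ κ') (h : MD α κ δ ι) :
    MD α κ' δ ι := by
  intro A hA
  obtain ⟨p, hp⟩ := h A hA
  refine ⟨p.comp (Pat.re e), fun x => ?_⟩
  rw [Pat.ev_comp]
  exact hp _

theorem split_type (ι : Type) [Finite ι] (a b : ℕ) (h : a + b ≤ Nat.card ι) :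
    ∃ c, b ≤ c ∧ Nonempty (Fin a ⊕ Fin c ≃ ι) := by
  obtain ⟨n, ⟨e⟩⟩ := Finite.exists_equiv_fin ι
  rw [Nat.card_congr e, Nat.card_fin] at h
  refine ⟨n - a, by omega, ⟨finSumFinEquiv.trans ((finCongr (by omega)).trans e.symm)⟩⟩

/-- Density Hales-Jewett for `κ`-subspaces. -/
def DHJ (α κ : Type) [Finite α] : Prop := ∀ δ : ℝ, 0 < δ → ∃ N : ℕ, ∀ (ι : Type) [Finite ι], N ≤ Nat.card ι → MD α κ δ ι

theorem dhj_multi {α : Type} [Finite α] [Nonempty α] (h : DHJ α (Fin 1)) (d : ℕ) : DHJ α (Fin d) := by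
  induction d with
  | zero =>
    intro δ hδ
    refine ⟨0, fun ι _ _ A hA => ?_⟩
    obtain ⟨x, hx⟩ := ex_exists hA
    have hxA : x ∈ A := by
      by_contra hc
      rw [ind_f hc] at hx; linarith
    refine ⟨⟨fun i => Sum.inl (x i), fun c => c.elim0⟩, fun y => ?_⟩
    exact hxA
  | succ d ih =>
    intro δ hδ
    obtain ⟨N1, h1⟩ := h (δ / 2) (by positivity)
    have h1' := h1 (Fin N1) (by simp)
    obtain ⟨N2, h2⟩ := ih (δ / 2 / (Nat.card (Pat α (Fin 1) (Fin N1)) + 1)) (by positivity)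
    refine ⟨N1 + N2, fun ι _ hι => ?_⟩
    obtain ⟨c, hc, ⟨e⟩⟩ := split_type ι N1 N2 hι
    refine MD.equiv e ?_
    refine MD.params (finSumFinEquiv.trans (finCongr (by omega)) : Fin 1 ⊕ Fin d ≃ Fin (d + 1)) ?_
    intro A hA
    unfold dens at hA
    rw [ex_sumfn, ex_comm] at hA
    have hm := ex_markov (fun y => ex_le fun x => ind_le _) hA hδ.le
    obtain ⟨p, hp⟩ := ex_pigeon (ι := Pat α (Fin 1) (Fin N1)) (g := fun p (y : Fin c → α) => ind (∀ x, Sum.elim (p.ev x) y ∈ A))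
      (fun _ _ => ind_nn _) (by
        intro y hy
        have hy' : δ / 2 ≤ ex fun x : Fin N1 → α => ind (Sum.elim x y ∈ A) := by
          by_contra hc
          rw [ind_f hc] at hy; linarith
        obtain ⟨p, hp⟩ := h1' {x | Sum.elim x y ∈ A} hy'
        refine ⟨p, ind_mono fun _ => hp⟩) (by positivity) hm
    have : Nonempty (Pat α (Fin 1) (Fin N1)) := ⟨p⟩
    have hcard : (0 : ℝ) < Nat.card (Pat α (Fin 1) (Fin N1)) := by exact_mod_cast Nat.card_pos
    obtain ⟨q, hq⟩ := h2 (Fin c) (by simpa using hc) {y | ∀ x, Sum.elim (p.ev x) y ∈ A}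
      (le_trans (by gcongr; linarith) hp)
    refine ⟨p.sum q, fun x => ?_⟩
    rw [Pat.ev_sum]
    exact hq _ _

end SZ

namespace SZ
open Topology

def rr {α ι : Type} (i : α) (x : ι → Option α) : ι → Option α := fun c => some ((x c).getD i)

def Ins {α ι : Type} (i : α) (E : Set (ι → Option α)) : Prop := ∀ x, x ∈ E ↔ rr i x ∈ E

theorem Ins.congr {α ι : Type} {i : α} {E : Set (ι → Option α)} (h : Ins i E) {x y : ι → Option α}
    (hxy : ∀ c, (x c).getD i = (y c).getD i) : x ∈ E ↔ y ∈ E := by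
  rw [h x, h y]
  have : rr i x = rr i y := by ext1 c; simp [rr, hxy]
  rw [this]

theorem rr_getD {α ι : Type} (i : α) (x : ι → Option α) (c : ι) : (rr i x c).getD i = (x c).getD i := by simp [rr]

def mix {α ι : Type} (z : ι → Option α) (u : ι → α) : ι → Option α := fun c => (z c).map fun _ => u c

theorem ex_mix {α ι : Type} [Finite α] [Nonempty α] [Finite ι] (f : (ι → Option α) → ℝ) :
    (ex fun z : ι → Option α => ex fun u : ι → α => f (mix z u)) = ex f := by
  let F : (ι → Option α) × (ι → α) → (ι → Option α) × (ι → α) := fun p => (mix p.1 p.2, fun c => (p.1 c).getD (p.2 c))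
  have hF : Function.Involutive F := by
    rintro ⟨z, u⟩
    refine Prod.ext ?_ ?_
    · ext1 c; simp only [F, mix]; cases z c <;> simp
    · ext1 c; simp only [F, mix]; cases z c <;> simp
  rw [← ex_prod (fun p : (ι → Option α) × (ι → α) => f (mix p.1 p.2))]
  have := ex_equiv hF.toPerm (fun p => f p.1)
  rw [ex_prod (fun p : (ι → Option α) × (ι → α) => f p.1)] at this
  simp only [ex_const] at this
  exact this

theorem lemQ {α : Type} [Finite α] [Nonempty α] {d : ℕ} (h : DHJ α (Fin d)) (β : ℝ) (hβ : 0 < β) :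
    ∃ r : ℕ, ∀ (ι : Type) [Finite ι], r ≤ Nat.card ι → ∀ (i : α) (E : Set (ι → Option α)), Ins i E → β ≤ dens E →
      ∃ p : Pat (Option α) (Fin d) ι, ∀ x, p.ev x ∈ E := by
  classical
  obtain ⟨M, hM⟩ := h (β / 2) (by positivity)
  obtain ⟨a0⟩ := (inferInstance : Nonempty α)
  obtain ⟨r, hr⟩ := conc (Option α) (some a0) M (β / 2) (by positivity)
  refine ⟨r, fun ι _ hι i E hE hd => ?_⟩
  unfold dens at hd
  rw [← ex_mix] at hd
  have hc := hr ι hι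
  have h1 : β / 2 ≤ ex fun z : ι → Option α => (ex fun u : ι → α => ind (mix z u ∈ E)) -
      ind (Nat.card {c // z c = some a0} < M) := by
    rw [ex_sub]; linarith
  obtain ⟨z, hz⟩ := ex_exists h1
  have hzM : M ≤ Nat.card {c // z c = some a0} := by
    by_contra hcc
    rw [ind_t (not_le.1 hcc)] at hz
    have : (ex fun u : ι → α => ind (mix z u ∈ E)) ≤ 1 := ex_le fun _ => ind_le _
    linarith
  have hz2 : β / 2 ≤ ex fun u : ι → α => ind (mix z u ∈ E) := by
    have := ind_nn (Nat.card {c // z c = some a0} < M)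
    linarith
  have hcard : M ≤ Nat.card {c // z c ≠ none} := hzM.trans
    (Nat.card_le_card_of_injective (fun c => (⟨c.1, by rw [c.2]; simp⟩ : {c // z c ≠ none}))
      (fun a b hab => by simpa [Subtype.ext_iff] using hab))
  rw [ex_split (fun c => z c ≠ none)] at hz2
  obtain ⟨v, hv⟩ := ex_exists hz2
  obtain ⟨q, hq⟩ := hM {c // z c ≠ none} hcard
    {x | mix z (fun c => if h : z c ≠ none then x ⟨c, h⟩ else v ⟨c, h⟩) ∈ E} hv
  refine ⟨⟨fun c => if h : z c ≠ none then Sum.map some id (q.f ⟨c, h⟩) else Sum.inl none, fun j => ?_⟩, fun x => ?_⟩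
  · obtain ⟨c, hc⟩ := q.surj j
    exact ⟨c.1, by simp only [dif_pos c.2, Subtype.coe_eta, hc, Sum.map_inr, id]⟩
  · refine (hE.congr fun c => ?_).1 (hq fun j => (x j).getD i)
    simp only [mix, Pat.ev]
    by_cases hzc : z c = none
    · simp [hzc]
    · rw [dif_pos hzc, dif_pos hzc]
      obtain ⟨b, hb⟩ := Option.ne_none_iff_exists'.1 hzc
      rw [hb]
      simp only [Option.map_some, Option.getD_some]
      cases q.f ⟨c, hzc⟩ <;> simp

/-- All `κ`-subspaces have nonpositive mean. -/
def NP {α ι : Type} [Finite α] (d : ℕ) (w : (ι → α) → ℝ) : Prop := ∀ p : Pat α (Fin d) ι, (ex fun x => w (p.ev x)) ≤ 0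

theorem dom_aux {α : Type} [Finite α] [Nonempty α] {d r : ℕ} {β c : ℝ} (hβ : 0 < β) (hβ1 : β ≤ 1)
    (hr : ∀ (i : α) (E : Set (Fin r → Option α)), Ins i E → β / 2 ≤ dens E →
      ∃ p : Pat (Option α) (Fin d) (Fin r), ∀ x, p.ev x ∈ E)
    (hc : c = β / 2 / (Nat.card (Pat (Option α) (Fin d) (Fin r)) + 1) / Nat.card (Fin r → Option α)) (s : ℕ) :
    ∀ (ι : Type) [Finite ι], s * r ≤ Nat.card ι → ∀ (i : α) (E : Set (ι → Option α)) (w : (ι → Option α) → ℝ),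
      Ins i E → (∀ x, w x ≤ 1) → NP d w → (ex fun x => ind (x ∈ E) * w x) ≤ β + (1 - c) ^ s * dens E := by
  have hXp : (0 : ℝ) < Nat.card (Fin r → Option α) := by exact_mod_cast Nat.card_pos
  have hX1 : (1 : ℝ) ≤ Nat.card (Fin r → Option α) := by exact_mod_cast Nat.card_pos
  have hc0 : 0 ≤ c := by rw [hc]; positivity
  have triv : ∀ (ι : Type) [Finite ι] (E : Set (ι → Option α)) (w : (ι → Option α) → ℝ), (∀ x, w x ≤ 1) →
      (ex fun x => ind (x ∈ E) * w x) ≤ dens E := fun ι _ E w hw =>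
    ex_mono fun x => mul_le_of_le_one_right (ind_nn _) (hw x)
  have densnn : ∀ (X : Type) [Finite X] (E : Set X), 0 ≤ dens E := fun X _ E => ex_nn fun _ => ind_nn _
  have densle : ∀ (X : Type) [Finite X] [Nonempty X] (E : Set X), dens E ≤ 1 := fun X _ _ E => ex_le fun _ => ind_le _
  induction s with
  | zero =>
    intro ι _ hι i E w hE hw hnp
    have := triv ι E w hw
    rw [pow_zero]; linarith
  | succ s ih =>
    intro ι _ hι i E w hE hw hnp
    by_cases hdE : dens E ≤ β
    · have := triv ι E w hw
      have hc1 : c ≤ 1 := by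
        rw [hc]
        refine (div_le_self (by positivity) hX1).trans ((div_le_self (by positivity) ?_).trans (by linarith))
        have : (0 : ℝ) ≤ Nat.card (Pat (Option α) (Fin d) (Fin r)) := Nat.cast_nonneg _
        linarith
      have : 0 ≤ (1 - c) ^ (s + 1) * dens E := mul_nonneg (pow_nonneg (by linarith) _) (densnn _ _)
      linarith
    push Not at hdE
    obtain ⟨n, hn, ⟨e⟩⟩ := split_type ι r (s * r) (by rw [add_mul] at hι; omega)
    -- transport
    have key : ∀ (E : Set (Fin r ⊕ Fin n → Option α)) (w : (Fin r ⊕ Fin n → Option α) → ℝ), β < dens E →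
        Ins i E → (∀ x, w x ≤ 1) → NP d w → (ex fun x => ind (x ∈ E) * w x) ≤ β + (1 - c) ^ (s + 1) * dens E := by
      clear hdE hnp hw hE w E
      intro E w hdE hE hw hnp
      have hdE' := hdE.le
      unfold dens at hdE'
      rw [ex_sumfn, ex_comm] at hdE'
      have hm := ex_markov (fun y => ex_le fun x => ind_le _) hdE' hβ.le
      obtain ⟨p, hp⟩ := ex_pigeon (ι := Pat (Option α) (Fin d) (Fin r))
        (g := fun p (y : Fin n → Option α) => ind (∀ x, Sum.elim (p.ev x) y ∈ E))
        (fun _ _ => ind_nn _) (by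
          intro y hy
          have hy' : β / 2 ≤ ex fun x : Fin r → Option α => ind (Sum.elim x y ∈ E) := by
            by_contra hc
            rw [ind_f hc] at hy; linarith
          obtain ⟨p, hp⟩ := hr i {x | Sum.elim x y ∈ E} (fun x => hE.congr fun c => by
            rcases c with c | c <;> simp [rr]) hy'
          refine ⟨p, ind_mono fun _ => hp⟩) (by positivity) hm
      set B : Set (Fin n → Option α) := {y | ∀ x, Sum.elim (p.ev x) y ∈ E} with hB
      have hdB : c * Nat.card (Fin r → Option α) ≤ dens B := by
        have : Nonempty (Pat (Option α) (Fin d) (Fin r)) := ⟨p⟩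
        have hcard : (0 : ℝ) < Nat.card (Pat (Option α) (Fin d) (Fin r)) := by exact_mod_cast Nat.card_pos
        rw [hc, div_mul_cancel₀ _ hXp.ne']
        exact le_trans (by gcongr; linarith) hp
      have hc1 : c ≤ 1 := by
        have := densle _ B
        nlinarith
      -- split
      let R : Set (Fin r → Option α) := Set.range p.ev
      have hBE : ∀ z y, z ∈ R → y ∈ B → Sum.elim z y ∈ E := by
        rintro _ y ⟨x, rfl⟩ hy; exact hy x
      have hsec : ∀ z, (ex fun y => ind (Sum.elim z y ∈ E ∧ ¬ (z ∈ R ∧ y ∈ B)) * w (Sum.elim z y)) ≤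
          β + (1 - c) ^ s * ex fun y => ind (Sum.elim z y ∈ E ∧ ¬ (z ∈ R ∧ y ∈ B)) := by
        intro z
        refine ih (Fin n) (by simpa using hn) i {y | Sum.elim z y ∈ E ∧ ¬ (z ∈ R ∧ y ∈ B)} (fun y => w (Sum.elim z y)) ?_
          (fun y => hw _) ?_
        · intro y
          have h1 : ∀ z : Fin r → Option α, Sum.elim z y ∈ E ↔ Sum.elim z (rr i y) ∈ E := fun z => hE.congr fun c => by
            rcases c with c | c <;> simp [rr]
          have h2 : y ∈ B ↔ rr i y ∈ B := by
            simp only [hB, Set.mem_ofPred_eq, ← h1]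
          simp only [Set.mem_ofPred_eq, ← h1, ← h2]
        · intro q
          have := hnp (Pat.right z q)
          simpa only [Pat.ev_right] using this
      have hsum := ex_mono hsec
      rw [ex_add, ex_const, ex_mul] at hsum
      have hsp : ∀ z y, ind (Sum.elim z y ∈ E) = ind (Sum.elim z y ∈ E ∧ ¬ (z ∈ R ∧ y ∈ B)) + ind (z ∈ R) * ind (y ∈ B) := by
        intro z y
        by_cases hz : z ∈ R <;> by_cases hy : y ∈ B <;> simp [hz, hy, ind_t, ind_f, hBE]
      have hRsum : ∀ g : (Fin r → Option α) → ℝ, (ex fun z => ind (z ∈ R) * g z) =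
          (Nat.card (Fin d → Option α) / Nat.card (Fin r → Option α)) * ex fun x => g (p.ev x) := by
        intro g
        classical
        have := Fintype.ofFinite α
        rw [ex_eq, ex_eq]
        have : ∑ z, ind (z ∈ R) * g z = ∑ x, g (p.ev x) := by
          rw [← Finset.sum_image (f := g) (g := p.ev) (s := Finset.univ) (fun a _ b _ h => p.ev_inj h),
            ← Finset.sum_subset (Finset.subset_univ (Finset.univ.image p.ev))]
          · refine Finset.sum_congr rfl fun z hz => ?_
            rw [ind_t (by simpa [R] using hz), one_mul]
          · intro z _ hz
            rw [ind_f (by simpa [R] using hz), zero_mul]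
        rw [this, Nat.card_eq_fintype_card, Nat.card_eq_fintype_card]
        have : (0 : ℝ) < Fintype.card (Fin d → Option α) := by exact_mod_cast Fintype.card_pos
        field_simp
      have hYp : (1 : ℝ) ≤ Nat.card (Fin d → Option α) := by exact_mod_cast Nat.card_pos
      -- the removed part
      have hrem : (ex fun z => ind (z ∈ R) * ex fun y => ind (y ∈ B) * w (Sum.elim z y)) ≤ 0 := by
        rw [hRsum, ex_comm]
        refine mul_nonpos_of_nonneg_of_nonpos (by positivity) ?_
        refine ex_le fun y => ?_
        rw [ex_mul]
        refine mul_nonpos_of_nonneg_of_nonpos (ind_nn _) ?_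
        have := hnp (Pat.left p y)
        simpa only [Pat.ev_left] using this
      have hdens : dens E = (ex fun z => ex fun y => ind (Sum.elim z y ∈ E ∧ ¬ (z ∈ R ∧ y ∈ B))) +
          ex fun z => ind (z ∈ R) * dens B := by
        unfold dens
        rw [ex_sumfn]
        simp only [hsp, ex_add, ex_mul]
      have hRB : c ≤ ex fun z => ind (z ∈ R) * dens B := by
        rw [hRsum, ex_const]
        calc c = c * Nat.card (Fin r → Option α) / Nat.card (Fin r → Option α) := by field_simp
          _ ≤ dens B / Nat.card (Fin r → Option α) := by gcongr
          _ ≤ (Nat.card (Fin d → Option α) * dens B) / Nat.card (Fin r → Option α) := by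
              gcongr; exact le_mul_of_one_le_left (densnn _ _) hYp
          _ = _ := by ring
      have hE1 := densle _ E
      have h3 : (ex fun z => ex fun y => ind (Sum.elim z y ∈ E ∧ ¬ (z ∈ R ∧ y ∈ B))) ≤ (1 - c) * dens E := by
        nlinarith
      have hpw : 0 ≤ (1 - c) ^ s := pow_nonneg (by linarith) _
      rw [ex_sumfn]
      simp only [hsp, add_mul, ex_add, mul_assoc, ex_mul]
      calc _ ≤ β + (1 - c) ^ s * ((1 - c) * dens E) + 0 :=
            add_le_add (hsum.trans (by gcongr)) hrem
        _ = _ := by ring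
    have ee := ex_equiv (Equiv.arrowCongr e (Equiv.refl (Option α)))
    have e1 := key {x | x ∘ e.symm ∈ E} (fun x => w (x ∘ e.symm)) (by
      refine hdE.trans_eq ?_
      unfold dens
      rw [← ee]; rfl) (fun x => hE.congr fun c => by simp [rr]) (fun x => hw _) (fun p => by
      have := hnp ((Pat.re e.symm).comp p)
      simpa only [Pat.ev_comp, Pat.ev_re] using this)
    have e2 : dens {x : Fin r ⊕ Fin n → Option α | x ∘ e.symm ∈ E} = dens E := by
      unfold dens; rw [← ee]; rfl
    rw [e2] at e1
    rw [← ee]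
    exact e1

theorem dom_single {α : Type} [Finite α] [Nonempty α] (h : ∀ d, DHJ α (Fin d)) (d : ℕ) (β : ℝ) (hβ : 0 < β) :
    ∃ N : ℕ, ∀ (ι : Type) [Finite ι], N ≤ Nat.card ι → ∀ (i : α) (E : Set (ι → Option α)) (w : (ι → Option α) → ℝ),
      Ins i E → (∀ x, w x ≤ 1) → NP d w → (ex fun x => ind (x ∈ E) * w x) ≤ β := by
  set b := min β 1 / 2 with hb
  have hb0 : 0 < b := by positivity
  have hbβ : 2 * b ≤ β := by have := min_le_left β 1; linarith
  have hb1 : b ≤ 1 := by have := min_le_right β 1; linarith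
  obtain ⟨r, hr⟩ := lemQ (h d) (b / 2) (by positivity)
  set c : ℝ := b / 2 / (Nat.card (Pat (Option α) (Fin d) (Fin r)) + 1) / Nat.card (Fin r → Option α) with hc
  have hXp : (0 : ℝ) < Nat.card (Fin r → Option α) := by exact_mod_cast Nat.card_pos
  have hX1 : (1 : ℝ) ≤ Nat.card (Fin r → Option α) := by exact_mod_cast Nat.card_pos
  have hc0 : 0 < c := by positivity
  have hc1 : c ≤ 1 := by
    rw [hc]
    refine (div_le_self (by positivity) hX1).trans ((div_le_self (by positivity) ?_).trans (by linarith))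
    have : (0 : ℝ) ≤ Nat.card (Pat (Option α) (Fin d) (Fin r)) := Nat.cast_nonneg _
    linarith
  obtain ⟨s, hs⟩ := exists_pow_lt_of_lt_one hb0 (by linarith : 1 - c < 1)
  refine ⟨s * r, fun ι _ hι i E w hE hw hnp => ?_⟩
  have h1 := dom_aux hb0 hb1 (fun i E hE hd => hr (Fin r) (by simp) i E hE hd) hc s ι hι i E w hE hw hnp
  have h2 : dens E ≤ 1 := ex_le fun _ => ind_le _
  have h3 : 0 ≤ dens E := ex_nn fun _ => ind_nn _
  have h4 : 0 ≤ (1 - c) ^ s := pow_nonneg (by linarith) _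
  nlinarith

theorem dom_multi {α : Type} [Finite α] [Nonempty α] (h : ∀ d, DHJ α (Fin d)) (J : Finset α) :
    ∀ (d : ℕ) (β : ℝ), 0 < β →
    ∃ N : ℕ, ∀ (ι : Type) [Finite ι], N ≤ Nat.card ι → ∀ (E : α → Set (ι → Option α)) (w : (ι → Option α) → ℝ),
      (∀ i ∈ J, Ins i (E i)) → (∀ x, w x ≤ 1) → NP d w → (ex fun x => ind (∀ i ∈ J, x ∈ E i) * w x) ≤ β := by
  classical
  induction J using Finset.induction_on with
  | empty =>
    intro d β hβ
    refine ⟨d, fun ι _ hι E w _ hw hnp => ?_⟩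
    obtain ⟨n, -, ⟨e⟩⟩ := split_type ι d 0 (by simpa using hι)
    refine le_trans ?_ hβ.le
    simp only [Finset.notMem_empty, false_imp_iff, implies_true, ind_t, one_mul]
    rw [← ex_equiv (Equiv.arrowCongr e (Equiv.refl (Option α))), ex_sumfn, ex_comm]
    refine ex_le fun y => ?_
    have := hnp ((Pat.re e.symm).comp (Pat.left (Pat.re (Equiv.refl _)) y))
    simp only [Pat.ev_comp, Pat.ev_re, Pat.ev_left] at this
    exact this
  | insert i J hi ih =>
    intro d β hβ
    obtain ⟨d1, h1⟩ := ih d (β / 2) (by positivity)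
    obtain ⟨N, hN⟩ := dom_single h d1 (β / 2) (by positivity)
    refine ⟨N, fun ι _ hι E w hE hw hnp => ?_⟩
    have h2 := hN ι hι i (E i) (fun x => ind (∀ j ∈ J, x ∈ E j) * w x - β / 2) (hE i (Finset.mem_insert_self _ _))
      (fun x => by
        have := mul_le_of_le_one_right (ind_nn (∀ j ∈ J, x ∈ E j)) (hw x)
        have := ind_le (∀ j ∈ J, x ∈ E j)
        linarith) (fun p => by
        rw [ex_sub, ex_const]
        have := h1 (Fin d1) (by simp) (fun j => {x | p.ev x ∈ E j}) (fun x => w (p.ev x))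
          (fun j hj x => (hE j (Finset.mem_insert_of_mem hj)).congr fun c => by
            simp only [Pat.ev]; cases p.f c <;> simp [rr]) (fun x => hw _) (fun q => by
            have := hnp (p.comp q)
            simpa only [Pat.ev_comp] using this)
        exact sub_nonpos.2 this)
    have h3 : (ex fun x => ind (∀ j ∈ insert i J, x ∈ E j) * w x) ≤
        ex fun x => ind (x ∈ E i) * (ind (∀ j ∈ J, x ∈ E j) * w x - β / 2) + β / 2 := by
      refine ex_mono fun x => ?_
      by_cases hx : x ∈ E i
      · have e : ind (∀ j ∈ insert i J, x ∈ E j) = ind (∀ j ∈ J, x ∈ E j) := ind_congr (by simp [hx])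
        rw [e, ind_t hx]; linarith
      · have e : ind (∀ j ∈ insert i J, x ∈ E j) = 0 := ind_f (by simp [hx])
        rw [e, ind_f hx]; linarith
    rw [ex_add, ex_const] at h3
    linarith

end SZ

namespace SZ
open Topology

def WW {α : Type} {m m0 : ℕ} (J : Fin m → Fin m0) (B : Fin m → Option α) (l : Fin m0 → Option α) : Fin m → Option α :=
  fun c => (B c).or (l (J c))

theorem step1 {α ν : Type} [Finite α] [Nonempty α] [Finite ν] {m m0 m' : ℕ} {δ θ : ℝ} (hδ : 0 < δ) (h0 : 0 < m0)
    (hm0 : MD α (Fin 1) (δ / 2) (Fin m0)) (hθ : θ = δ / 2 / Nat.card (Fin m0 → Option α))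
    (hm : ∀ j0 : Fin m0, (ex fun J : Fin m → Fin m0 => ind (Nat.card {c // J c = j0} < m')) ≤ θ / 2)
    (A : Set (Fin m ⊕ ν → Option α)) (hA : ∀ z, δ ≤ ex fun y : ν → Option α => ind (Sum.elim z y ∈ A)) :
    ∃ (κ : Type) (_ : Finite κ) (V : Pat (Option α) κ (Fin m)), m' ≤ Nat.card κ ∧ (∀ c, V.f c ≠ Sum.inl none) ∧
      θ / 2 ≤ ex fun x : κ → Option α => ex fun y : ν → Option α => ind (∀ i, Sum.elim (V.ev (rr i x)) y ∈ A) := by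
  classical
  have : Nonempty (Fin m0) := ⟨⟨0, h0⟩⟩
  have hcp : (0 : ℝ) < Nat.card (Fin m0 → Option α) := by exact_mod_cast Nat.card_pos
  have hθ0 : 0 < θ := by rw [hθ]; positivity
  let Ω := ((Fin m → Fin m0) × (Fin m → Option α)) × (ν → Option α)
  have h1 : δ ≤ ex fun ω : Ω => ex fun x : Fin m0 → α => ind (Sum.elim (WW ω.1.1 ω.1.2 fun j => some (x j)) ω.2 ∈ A) := by
    rw [ex_comm]
    refine le_ex fun x => ?_
    rw [ex_prod]
    exact le_ex fun p => hA (WW p.1 p.2 fun j => some (x j))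
  have h2 := ex_markov (fun y => ex_le fun x => ind_le _) h1 hδ.le
  obtain ⟨l, hl⟩ := ex_pigeon (ι := Fin m0 → Option α)
    (g := fun l (ω : Ω) => ind ((∃ j, l j = none) ∧ ∀ i, Sum.elim (rr i (WW ω.1.1 ω.1.2 l)) ω.2 ∈ A))
    (fun _ _ => ind_nn _) (by
      rintro ω hω
      have hω' : δ / 2 ≤ ex fun x : Fin m0 → α => ind (Sum.elim (WW ω.1.1 ω.1.2 fun j => some (x j)) ω.2 ∈ A) := by
        by_contra hc
        rw [ind_f hc] at hω; linarith
      obtain ⟨p, hp⟩ := hm0 {x | Sum.elim (WW ω.1.1 ω.1.2 fun j => some (x j)) ω.2 ∈ A} hω'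
      refine ⟨fun j => Sum.elim some (fun _ => none) (p.f j), ind_mono fun _ => ⟨?_, fun i => ?_⟩⟩
      · obtain ⟨j, hj⟩ := p.surj 0
        exact ⟨j, by simp [hj]⟩
      · have := hp fun _ => i
        have e : rr i (WW ω.1.1 ω.1.2 fun j => Sum.elim some (fun _ => none) (p.f j)) =
            WW ω.1.1 ω.1.2 fun j => some (p.ev (fun _ => i) j) := by
          ext1 c
          simp only [rr, WW, Pat.ev]
          cases ω.1.2 c <;> simp
          cases p.f (ω.1.1 c) <;> simp
        rw [e]; exact this) (by positivity) h2
  rw [← hθ] at hl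
  have hj : ∃ j, l j = none := by
    by_contra hc
    have : (ex fun ω : Ω => ind ((∃ j, l j = none) ∧ ∀ i, Sum.elim (rr i (WW ω.1.1 ω.1.2 l)) ω.2 ∈ A)) ≤ 0 :=
      ex_le fun ω => le_of_eq (ind_f fun h => hc h.1)
    linarith
  obtain ⟨j0, hj0⟩ := hj
  rw [ex_prod, ex_prod] at hl
  have h3 : θ / 2 ≤ ex fun J : Fin m → Fin m0 => (ex fun B : Fin m → Option α => ex fun y : ν → Option α =>
      ind (∀ i, Sum.elim (rr i (WW J B l)) y ∈ A)) - ind (Nat.card {c // J c = j0} < m') := by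
    rw [ex_sub]
    have := hm j0
    have : θ ≤ ex fun J : Fin m → Fin m0 => ex fun B : Fin m → Option α => ex fun y : ν → Option α =>
      ind (∀ i, Sum.elim (rr i (WW J B l)) y ∈ A) :=
      hl.trans (ex_mono fun J => ex_mono fun B => ex_mono fun y => ind_mono fun h => h.2)
    linarith
  obtain ⟨J, hJ⟩ := ex_exists h3
  have hJm : m' ≤ Nat.card {c // J c = j0} := by
    by_contra hc
    rw [ind_t (not_le.1 hc)] at hJ
    have : (ex fun B : Fin m → Option α => ex fun y : ν → Option α => ind (∀ i, Sum.elim (rr i (WW J B l)) y ∈ A)) ≤ 1 :=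
      ex_le fun _ => ex_le fun _ => ind_le _
    linarith
  have hJ2 : θ / 2 ≤ ex fun B : Fin m → Option α => ex fun y : ν → Option α =>
      ind (∀ i, Sum.elim (rr i (WW J B l)) y ∈ A) := by
    have := ind_nn (Nat.card {c // J c = j0} < m')
    linarith
  rw [ex_split (fun c => l (J c) = none)] at hJ2
  obtain ⟨v, hv⟩ := ex_exists hJ2
  let V : Pat (Option α) {c // l (J c) = none} (Fin m) :=
    ⟨fun c => if h : l (J c) = none then Sum.inr ⟨c, h⟩ else Sum.inl ((v ⟨c, h⟩).or (l (J c))),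
      fun c => ⟨c.1, by simp [c.2]⟩⟩
  have hVn : ∀ c, V.f c ≠ Sum.inl none := by
    intro c
    by_cases h : l (J c) = none
    · simp [V, h]
    · simp [V, h]
  refine ⟨{c // l (J c) = none}, inferInstance, V, ?_, hVn, ?_⟩
  · refine hJm.trans (Nat.card_le_card_of_injective
      (fun c => (⟨c.1, by rw [c.2]; exact hj0⟩ : {c // l (J c) = none}))
      (fun a b hab => by simpa [Subtype.ext_iff] using hab))
  · refine hv.trans (ex_mono fun x => ex_mono fun y => ind_mono fun h i => ?_)
    have := h i
    have e : V.ev (rr i x) = rr i (WW J (fun c => if h : l (J c) = none then x ⟨c, h⟩ else v ⟨c, h⟩) l) := by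
      ext1 c
      by_cases h : l (J c) = none
      · simp [V, Pat.ev, rr, WW, h]
      · simp only [V, Pat.ev, rr, WW, h, dite_false, Sum.elim_inl, id]
        obtain ⟨b, hb⟩ := Option.ne_none_iff_exists'.1 h
        rcases v ⟨c, h⟩ with _ | a
        · simp only [Option.none_or]; simp [hb]
        · simp
    rw [e]; exact this

theorem step2 {α ν κ : Type} [Finite α] [Nonempty α] [LinearOrder α] [Finite ν] [Finite κ] {m d : ℕ} {δ θ γ η : ℝ}
    (hγ : 0 < γ) (hη : η + η + γ + Nat.card α * γ ≤ δ * θ)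
    (V : Pat (Option α) κ (Fin m)) (hVn : ∀ c, V.f c ≠ Sum.inl none)
    (A : Set (Fin m ⊕ ν → Option α)) (hA : ∀ z, δ - η ≤ ex fun y : ν → Option α => ind (Sum.elim z y ∈ A))
    (hV : θ ≤ ex fun x : κ → Option α => ex fun y : ν → Option α => ind (∀ i, Sum.elim (V.ev (rr i x)) y ∈ A))
    (hκ : (ex fun x : κ → Option α => ind (Nat.card {c // x c = none} < 1)) ≤ η)
    (hdom : ∀ (E : α → Set (κ → Option α)) (w : (κ → Option α) → ℝ),
      (∀ i, Ins i (E i)) → (∀ x, w x ≤ 1) → NP d w → (ex fun x => ind (∀ i, x ∈ E i) * w x) ≤ γ / 2)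
    (hd : MD (Option α) (Fin 1) (δ + γ) (Fin d)) (hδ : 0 < δ) (hθ : 0 ≤ θ) :
    ∃ p : Pat (Option α) (Fin 1) (Fin m ⊕ ν), ∀ x, p.ev x ∈ A := by
  classical
  by_contra hno
  have := Fintype.ofFinite α
  have hVr : ∀ i x, V.ev (rr i x) = rr i (V.ev x) := by
    intro i x
    ext1 c
    simp only [Pat.ev, rr]
    have := hVn c
    rcases hc : V.f c with (a | a) | a
    · exact absurd hc this
    · simp
    · simp [rr]
  -- sets
  let D : (ν → Option α) → α → Set (κ → Option α) := fun y i => {x | Sum.elim (V.ev (rr i x)) y ∈ A}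
  let A' : (ν → Option α) → Set (κ → Option α) := fun y => {x | Sum.elim (V.ev x) y ∈ A}
  let E : (ν → Option α) → α → α → Set (κ → Option α) := fun y j i =>
    if i < j then D y i else if i = j then (D y i)ᶜ else Set.univ
  have hDI : ∀ y i, Ins i (D y i) := by
    intro y i x
    have : rr i (rr i x) = rr i x := by ext1 c; simp [rr]
    simp only [D, Set.mem_ofPred_eq, this]
  have hEI : ∀ y j i, Ins i (E y j i) := by
    intro y j i
    simp only [E]
    split_ifs
    · exact hDI y i
    · intro x; simp only [Set.mem_compl_iff]; exact not_congr (hDI y i x)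
    · intro x; simp
  -- no line
  have hcap : ∀ y x, x ∈ A' y → (∀ i, x ∈ D y i) → Nat.card {c // x c = none} < 1 := by
    intro y x hx hxD
    by_contra hc
    have : Nonempty {c // x c = none} := by
      by_contra hemp
      rw [not_nonempty_iff] at hemp
      rw [Nat.card_of_isEmpty] at hc
      exact hc one_pos
    obtain ⟨c0, hc0⟩ := this
    apply hno
    obtain ⟨i0, hi0⟩ := V.surj c0
    have hn : V.ev x i0 = none := by simp [Pat.ev, hi0, hc0]
    let p : Pat (Option α) (Fin 1) (Fin m ⊕ ν) := ⟨Sum.elim (fun c => (V.ev x c).elim (Sum.inr 0) fun a => Sum.inl (some a))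
      (fun t => Sum.inl (y t)), fun t => ⟨Sum.inl i0, by simp [hn, Subsingleton.elim t 0]⟩⟩
    have hp : ∀ u, p.ev u = Sum.elim (fun c => (V.ev x c).or (u 0)) y := by
      intro u
      ext1 c
      rcases c with c | c
      · simp only [p, Pat.ev, Sum.elim_inl]
        rcases Sum.elim id x (V.f c) with _ | a <;> simp
      · simp [p, Pat.ev]
    refine ⟨p, fun u => ?_⟩
    rw [hp]
    cases hu : u 0 with
    | none => simp only [Option.or_none]; exact hx
    | some i =>
      have h1 := hxD i
      simp only [D, hVr, Set.mem_ofPred_eq] at h1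
      convert h1 using 2
      ext1 c
      simp only [rr]
      rcases V.ev x c with _ | a <;> simp
  -- main pointwise inequality
  have hpt : ∀ y x, ind (x ∈ A' y) - (δ + γ) + (δ + γ) * ind (∀ i, x ∈ D y i) - ind (Nat.card {c // x c = none} < 1) ≤
      ∑ j, ind (∀ i, x ∈ E y j i) * (ind (x ∈ A' y) - (δ + γ)) := by
    intro y x
    by_cases hall : ∀ i, x ∈ D y i
    · have : ∀ j, ind (∀ i, x ∈ E y j i) = 0 := fun j => ind_f fun h => by
        have := h j
        simp only [E, lt_irrefl, if_false, if_true] at this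
        exact this (hall j)
      simp only [this, zero_mul, Finset.sum_const_zero, ind_t hall]
      have : ind (x ∈ A' y) ≤ ind (Nat.card {c // x c = none} < 1) := ind_mono fun hx => hcap y x hx hall
      linarith
    · have hne : (Finset.univ.filter fun i => x ∉ D y i).Nonempty := by
        push Not at hall
        obtain ⟨i, hi⟩ := hall
        exact ⟨i, by simpa using hi⟩
      let j := (Finset.univ.filter fun i => x ∉ D y i).min' hne
      have hj : x ∉ D y j := by
        have := Finset.min'_mem _ hne
        simpa using (Finset.mem_filter.1 this).2
      have hjm : ∀ i, i < j → x ∈ D y i := by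
        intro i hi
        by_contra hc
        exact absurd (Finset.min'_le _ i (by simpa using hc)) (not_le.2 hi)
      rw [Finset.sum_eq_single j]
      · have : ∀ i, x ∈ E y j i := by
          intro i
          simp only [E]
          split_ifs with h1 h2
          · exact hjm i h1
          · rw [h2]; exact hj
          · trivial
        rw [ind_t this, ind_f hall]
        have := ind_nn (Nat.card {c // x c = none} < 1)
        linarith
      · intro j' _ hj'
        rw [ind_f, zero_mul]
        intro h
        rcases lt_or_gt_of_ne hj' with hlt | hgt
        · have := h j'
          simp only [E, lt_irrefl, if_false, if_true] at this
          exact this (hjm j' hlt)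
        · have := h j
          simp only [E, hgt, if_true] at this
          exact hj this
      · simp
  -- each piece is small
  have hpc : ∀ y j, (ex fun x => ind (∀ i, x ∈ E y j i) * (ind (x ∈ A' y) - (δ + γ))) ≤ γ / 2 := by
    intro y j
    refine hdom (E y j) (fun x => ind (x ∈ A' y) - (δ + γ)) (hEI y j) (fun x => by
      have := ind_le (x ∈ A' y); linarith) ?_
    intro p
    by_contra hc
    rw [ex_sub, ex_const] at hc
    obtain ⟨q, hq⟩ := hd {x | p.ev x ∈ A' y} (by unfold dens; simp only [Set.mem_ofPred_eq]; linarith)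
    refine hno ⟨Pat.left (V.comp (p.comp q)) y, fun x => ?_⟩
    rw [Pat.ev_left, Pat.ev_comp, Pat.ev_comp]
    exact hq x
  have h1 := ex_mono fun y => ex_mono (hpt y)
  have h2 : (ex fun y => ex fun x => ∑ j, ind (∀ i, x ∈ E y j i) * (ind (x ∈ A' y) - (δ + γ))) ≤ Nat.card α * (γ / 2) := by
    refine ex_le fun y => ?_
    rw [ex_sum]
    refine (Finset.sum_le_sum fun j _ => hpc y j).trans (le_of_eq ?_)
    simp
  simp only [ex_sub, ex_add, ex_mul, ex_const] at h1
  have h3 : δ - η ≤ ex fun y => ex fun x => ind (x ∈ A' y) := by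
    rw [ex_comm]; exact le_ex fun x => hA _
  have h4 : θ ≤ ex fun y => ex fun x => ind (∀ i, x ∈ D y i) := by
    rw [ex_comm]; exact hV
  have h5 := mul_le_mul_of_nonneg_left h4 (by linarith : 0 ≤ δ + γ)
  have hq0 : (0 : ℝ) < Nat.card α := by exact_mod_cast Nat.card_pos
  nlinarith [mul_nonneg hγ.le hθ, mul_pos hq0 hγ]

theorem incr {α : Type} [Finite α] [Nonempty α] [LinearOrder α] (h : ∀ d, DHJ α (Fin d)) (δ : ℝ) (hδ : 0 < δ)
    (hg : ∀ ε : ℝ, 0 < ε → ∃ N : ℕ, ∀ (ι : Type) [Finite ι], N ≤ Nat.card ι → MD (Option α) (Fin 1) (δ + ε) ι) :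
    ∃ τ : ℝ, 0 < τ ∧ ∃ N : ℕ, ∀ (ι : Type) [Finite ι], N ≤ Nat.card ι → MD (Option α) (Fin 1) (δ - τ) ι := by
  have := Fintype.ofFinite α
  obtain ⟨m1, hm1⟩ := h 1 (δ / 2 / 2) (by positivity)
  set m0 := m1 + 1 with hm0
  have hcp : (0 : ℝ) < Nat.card (Fin m0 → Option α) := by exact_mod_cast Nat.card_pos
  obtain ⟨θ, hθ⟩ : ∃ θ : ℝ, θ = δ / 2 / 2 / Nat.card (Fin m0 → Option α) := ⟨_, rfl⟩
  have hθ0 : 0 < θ := by rw [hθ]; positivity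
  obtain ⟨γ, hγ⟩ : ∃ γ : ℝ, γ = δ * θ / (8 * (Nat.card α + 1)) := ⟨_, rfl⟩
  have hγ0 : 0 < γ := by rw [hγ]; positivity
  have hγe : γ + Nat.card α * γ = δ * θ / 8 := by rw [hγ]; field_simp; ring
  obtain ⟨η, hη⟩ : ∃ η : ℝ, η = min (δ * θ / 16) (δ / 2) := ⟨_, rfl⟩
  have hη0 : 0 < η := by rw [hη]; positivity
  have hη1 : η ≤ δ * θ / 16 := hη.trans_le (min_le_left _ _)
  have hη2 : η ≤ δ / 2 := hη.trans_le (min_le_right _ _)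
  obtain ⟨d, hd⟩ := hg γ hγ0
  obtain ⟨N', hN'⟩ := dom_multi h Finset.univ d (γ / 2) (by positivity)
  obtain ⟨M, hM⟩ := conc (Option α) none 1 η hη0
  have hcc := fun j0 : Fin m0 => conc (Fin m0) j0 (max N' M) (θ / 2) (by positivity)
  choose f hf using hcc
  obtain ⟨m, hm⟩ : ∃ m, m = Finset.univ.sup f := ⟨_, rfl⟩
  have hfm : ∀ j, f j ≤ m := fun j => hm ▸ Finset.le_sup (Finset.mem_univ j)
  have hcm : (0 : ℝ) < Nat.card (Fin m → Option α) := by exact_mod_cast Nat.card_pos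
  obtain ⟨τ, hτ⟩ : ∃ τ : ℝ, τ = η / (2 * Nat.card (Fin m → Option α)) := ⟨_, rfl⟩
  have hτ0 : 0 < τ := by rw [hτ]; positivity
  have hτe : Nat.card (Fin m → Option α) * (2 * τ) = η := by rw [hτ]; field_simp
  obtain ⟨Nν, hNν⟩ := hg τ hτ0
  refine ⟨τ, hτ0, m + Nν, fun ι _ hι => ?_⟩
  obtain ⟨c, hc, ⟨e⟩⟩ := split_type ι m Nν hι
  refine MD.equiv e ?_
  intro A hA
  by_contra hno
  have hup : ∀ z, (ex fun y : Fin c → Option α => ind (Sum.elim z y ∈ A)) ≤ δ + τ := by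
    intro z
    by_contra hcon
    obtain ⟨p, hp⟩ := hNν (Fin c) (by simpa using hc) {y | Sum.elim z y ∈ A} (not_le.1 hcon).le
    refine hno ⟨Pat.right z p, fun x => ?_⟩
    rw [Pat.ev_right]; exact hp x
  have hlo : ∀ z, δ - η ≤ ex fun y : Fin c → Option α => ind (Sum.elim z y ∈ A) := by
    intro z
    unfold dens at hA
    rw [ex_sumfn] at hA
    have := ex_all_ge hA hup z
    refine le_trans ?_ this
    have : δ + τ - (δ - τ) = 2 * τ := by ring
    rw [this, hτe]; linarith
  obtain ⟨κ, hκf, V, hκ, hVn, hV⟩ := step1 (δ := δ / 2) (θ := θ) (m' := max N' M) (by positivity) (Nat.succ_pos m1)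
    (hm1 (Fin m0) (by simp [hm0])) hθ (fun j => hf j (Fin m) (by simpa using hfm j)) A
    (fun z => le_trans (by linarith) (hlo z))
  refine hno (step2 (δ := δ) (θ := θ / 2) (γ := γ) (η := η) (d := d) hγ0 (by nlinarith) V hVn A hlo hV
    (hM κ ((le_max_right _ _).trans hκ)) ?_ (hd (Fin d) (by simp)) hδ (by positivity))
  intro E w hE hw hnp
  have := hN' κ ((le_max_left _ _).trans hκ) E w (fun i _ => hE i) hw hnp
  simpa using this

theorem dhj_option {α : Type} [Finite α] [Nonempty α] [LinearOrder α] (h : ∀ d, DHJ α (Fin d)) : DHJ (Option α) (Fin 1) := by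
  by_contra hcon
  unfold DHJ at hcon
  push Not at hcon
  obtain ⟨δ1, hδ1, hbad⟩ := hcon
  let G : Set ℝ := {δ | ∃ N : ℕ, ∀ (ι : Type) [Finite ι], N ≤ Nat.card ι → MD (Option α) (Fin 1) δ ι}
  have hup : ∀ a b, a ∈ G → a ≤ b → b ∈ G := by
    rintro a b ⟨N, hN⟩ hab
    exact ⟨N, fun ι _ hι => (hN ι hι).mono hab⟩
  have h1 : δ1 ∉ G := by
    rintro ⟨N, hN⟩
    obtain ⟨ι, _, hι, hb⟩ := hbad N
    exact hb (hN ι hι)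
  have hlb : ∀ a ∈ G, δ1 ≤ a := by
    intro a ha
    by_contra hc
    exact h1 (hup a δ1 ha (not_le.1 hc).le)
  have h2 : (2 : ℝ) ∈ G := by
    refine ⟨0, fun ι _ _ A hA => ?_⟩
    have : dens A ≤ 1 := ex_le fun _ => ind_le _
    linarith
  have hbdd : BddBelow G := ⟨δ1, hlb⟩
  have h0 : δ1 ≤ sInf G := le_csInf ⟨2, h2⟩ hlb
  obtain ⟨τ, hτ, hG⟩ := incr h (sInf G) (by linarith) (fun ε hε => by
    obtain ⟨a, ha, hlt⟩ := exists_lt_of_csInf_lt ⟨2, h2⟩ (by linarith : sInf G < sInf G + ε)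
    exact hup a _ ha hlt.le)
  have := csInf_le hbdd hG
  linarith

theorem DHJ.alph {α β κ : Type} [Finite α] [Finite β] (e : α ≃ β) (h : DHJ α κ) : DHJ β κ := by
  intro δ hδ
  obtain ⟨N, hN⟩ := h δ hδ
  refine ⟨N, fun ι _ hι A hA => ?_⟩
  obtain ⟨p, hp⟩ := hN ι hι {x | e ∘ x ∈ A} (by
    refine hA.trans (le_of_eq ?_)
    unfold dens
    rw [← ex_equiv (Equiv.arrowCongr (Equiv.refl ι) e)]
    rfl)
  refine ⟨⟨fun i => Sum.map e id (p.f i), fun c => ?_⟩, fun x => ?_⟩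
  · obtain ⟨i, hi⟩ := p.surj c
    exact ⟨i, by simp [hi]⟩
  · have := hp (e.symm ∘ x)
    convert this using 1
    simp only [Set.mem_ofPred_eq]
    congr! 1
    ext1 i
    simp only [Pat.ev, Function.comp]
    cases p.f i <;> simp

theorem dhj_fin (k : ℕ) : DHJ (Fin (k + 1)) (Fin 1) := by
  induction k with
  | zero =>
    intro δ hδ
    refine ⟨1, fun ι _ hι A hA => ?_⟩
    obtain ⟨x, hx⟩ := ex_exists hA
    have hxA : x ∈ A := by
      by_contra hc
      rw [ind_f hc] at hx; linarith
    have : Nonempty ι := by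
      by_contra hemp
      rw [not_nonempty_iff] at hemp
      rw [Nat.card_of_isEmpty] at hι
      omega
    obtain ⟨i⟩ := this
    refine ⟨⟨fun _ => Sum.inr 0, fun c => ⟨i, by rw [Subsingleton.elim c 0]⟩⟩, fun y => ?_⟩
    convert hxA
    ext1 j
    exact Subsingleton.elim (α := Fin 1) _ _
  | succ k ih =>
    exact (dhj_option (dhj_multi ih)).alph (finSuccEquiv (k + 1)).symm

end SZ

namespace SZ
open Topology

theorem pat_sum {ℓ n : ℕ} (p : Pat (Fin (ℓ + 1)) (Fin 1) (Fin n)) :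
    ∃ a e : ℕ, a ≤ ℓ * n ∧ 1 ≤ e ∧ e ≤ n ∧ ∀ j : Fin (ℓ + 1),
      ∑ i, ((p.ev (fun _ => j) i : Fin (ℓ + 1)) : ℕ) = a + j * e := by
  refine ⟨∑ i, Sum.elim (fun a : Fin (ℓ + 1) => (a : ℕ)) (fun _ => 0) (p.f i),
    ∑ i, Sum.elim (fun _ : Fin (ℓ + 1) => 0) (fun _ => 1) (p.f i), ?_, ?_, ?_, ?_⟩
  · refine (Finset.sum_le_card_nsmul _ _ ℓ fun i _ => ?_).trans (by simp [mul_comm])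
    rcases p.f i with a | a
    · simpa using Nat.lt_succ_iff.1 a.2
    · simp
  · obtain ⟨i, hi⟩ := p.surj 0
    refine le_trans ?_ (Finset.single_le_sum (fun _ _ => Nat.zero_le _) (Finset.mem_univ i))
    rw [hi]; simp
  · refine (Finset.sum_le_card_nsmul _ _ 1 fun i _ => ?_).trans (by simp)
    rcases p.f i with a | a <;> simp
  · intro j
    rw [Finset.mul_sum, ← Finset.sum_add_distrib]
    refine Finset.sum_congr rfl fun i _ => ?_
    unfold Pat.ev
    rcases p.f i with a | a <;> simp

/-- Product of indicators along a progression. -/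
noncomputable def apx (ℓ : ℕ) (Λ : Set ℤ) (s x : ℤ) : ℝ :=
  ∏ j : Fin (ℓ + 1), ind (x + (j : ℤ) * s ∈ Λ)

theorem apx_nn (ℓ : ℕ) (Λ : Set ℤ) (s x : ℤ) : 0 ≤ apx ℓ Λ s x :=
  Finset.prod_nonneg fun _ _ => ind_nn _
theorem apx_le (ℓ : ℕ) (Λ : Set ℤ) (s x : ℤ) : apx ℓ Λ s x ≤ 1 :=
  Finset.prod_le_one (fun _ _ => ind_nn _) fun _ _ => ind_le _
theorem apx_bdd (ℓ : ℕ) (Λ : Set ℤ) (s : ℤ) : Bdd (apx ℓ Λ s) :=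
  Bdd.of1 fun x => abs_le.2 ⟨by linarith [apx_nn ℓ Λ s x], apx_le ℓ Λ s x⟩
theorem ind_bdd {Y : Type} (P : Y → Prop) : Bdd (fun y => ind (P y)) :=
  Bdd.of1 fun x => abs_le.2 ⟨by linarith [ind_nn (P x)], ind_le _⟩

theorem pointwise {ℓ n : ℕ} {δ : ℝ} (hδ : 0 < δ) (h : MD (Fin (ℓ + 1)) (Fin 1) δ (Fin n)) (Λ : Set ℤ) (d x : ℤ) :
    (ex fun w : Fin n → Fin (ℓ + 1) => ind (x + d * ∑ i, ((w i : ℕ) : ℤ) ∈ Λ)) - δ ≤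
      ∑ a ∈ Finset.range (ℓ * n + 1), ∑ e ∈ Finset.Icc 1 n, apx ℓ Λ (d * e) (x + d * a) := by
  have hnn : ∀ a ∈ Finset.range (ℓ * n + 1), 0 ≤ ∑ e ∈ Finset.Icc 1 n, apx ℓ Λ (d * e) (x + d * a) :=
    fun a _ => Finset.sum_nonneg fun e _ => apx_nn _ _ _ _
  by_cases hd : δ ≤ dens {w : Fin n → Fin (ℓ + 1) | x + d * ∑ i, ((w i : ℕ) : ℤ) ∈ Λ}
  · obtain ⟨p, hp⟩ := h _ hd
    obtain ⟨a, e, ha, he, hen, hs⟩ := pat_sum p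
    have h1 : apx ℓ Λ (d * e) (x + d * a) = 1 := by
      refine Finset.prod_eq_one fun j _ => ind_t ?_
      have h2 : x + d * ∑ i, ((p.ev (fun _ => j) i : ℕ) : ℤ) ∈ Λ := hp (fun _ => j)
      have h3 : ∑ i, ((p.ev (fun _ => j) i : ℕ) : ℤ) = a + j * e := by exact_mod_cast hs j
      rw [h3] at h2
      convert h2 using 1; ring
    have h4 : (ex fun w : Fin n → Fin (ℓ + 1) => ind (x + d * ∑ i, ((w i : ℕ) : ℤ) ∈ Λ)) ≤ 1 :=
      ex_le fun _ => ind_le _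
    have h5 := Finset.single_le_sum hnn (Finset.mem_range.2 (Nat.lt_succ_iff.2 ha))
    have h6 := Finset.single_le_sum (f := fun e : ℕ => apx ℓ Λ (d * e) (x + d * a))
      (fun e _ => apx_nn _ _ _ _) (Finset.mem_Icc.2 ⟨he, hen⟩)
    simp only [h1] at h6
    linarith
  · have h1 : (ex fun w : Fin n → Fin (ℓ + 1) => ind (x + d * ∑ i, ((w i : ℕ) : ℤ) ∈ Λ)) < δ := not_le.1 hd
    have := Finset.sum_nonneg hnn
    linarith

theorem mean_ex {X Y : Type} [Finite X] (μ : Mean Y) {f : X → Y → ℝ} (h : ∀ i, Bdd (f i)) :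
    μ (fun y => ex fun i => f i y) = ex fun i => μ (f i) := by
  have := Fintype.ofFinite X
  simp only [ex_eq, div_eq_inv_mul]
  rw [μ.smul _ (Bdd.sum _ fun i _ => h i), μ.sum _ fun i _ => h i]

theorem dil {ℓ n : ℕ} {δ : ℝ} (hδ : 0 < δ) (h : MD (Fin (ℓ + 1)) (Fin 1) (δ / 2) (Fin n)) (Λ : Set ℤ)
    (μ : Mean ℤ) (inv : ∀ t f, Bdd f → μ (fun x => f (x + t)) = μ f) (hμ : δ ≤ μ fun x => ind (x ∈ Λ)) (d : ℤ) :
    δ / 2 ≤ (ℓ * n + 1 : ℝ) * ∑ e ∈ Finset.Icc 1 n, μ (apx ℓ Λ (d * e)) := by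
  have hb1 : ∀ w : Fin n → Fin (ℓ + 1), Bdd fun x : ℤ => ind (x + d * ∑ i, ((w i : ℕ) : ℤ) ∈ Λ) := fun w => ind_bdd _
  have hb2 : Bdd fun x : ℤ => ex fun w : Fin n → Fin (ℓ + 1) => ind (x + d * ∑ i, ((w i : ℕ) : ℤ) ∈ Λ) :=
    Bdd.of1 fun x => abs_le.2 ⟨by linarith [ex_nn fun w : Fin n → Fin (ℓ + 1) => ind_nn (x + d * ∑ i, ((w i : ℕ) : ℤ) ∈ Λ)],
      ex_le fun _ => ind_le _⟩
  have hb4 : ∀ (a e : ℕ), Bdd fun x => apx ℓ Λ (d * e) (x + d * a) := fun a e => (apx_bdd _ _ _).comp _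
  have hb3 : ∀ a : ℕ, Bdd fun x => ∑ e ∈ Finset.Icc 1 n, apx ℓ Λ (d * e) (x + d * a) := fun a =>
    Bdd.sum _ fun e _ => hb4 a e
  have h1 := μ.mono (hb2.sub (Bdd.const _)) (Bdd.sum _ fun a _ => hb3 a)
    (fun x => pointwise (half_pos hδ) h Λ d x)
  rw [μ.sub hb2 (Bdd.const _), μ.const, mean_ex μ hb1, μ.sum _ fun a _ => hb3 a] at h1
  have h2 : ∀ w : Fin n → Fin (ℓ + 1), (μ fun x : ℤ => ind (x + d * ∑ i, ((w i : ℕ) : ℤ) ∈ Λ)) = μ fun x => ind (x ∈ Λ) :=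
    fun w => inv _ (fun x => ind (x ∈ Λ)) (ind_bdd _)
  simp only [h2, ex_const] at h1
  have h3 : ∀ a : ℕ, (μ fun x => ∑ e ∈ Finset.Icc 1 n, apx ℓ Λ (d * e) (x + d * a)) =
      ∑ e ∈ Finset.Icc 1 n, μ (apx ℓ Λ (d * e)) := fun a => by
    rw [μ.sum _ fun e _ => hb4 a e]
    exact Finset.sum_congr rfl fun e _ => inv _ _ (apx_bdd _ _ _)
  simp only [h3, Finset.sum_const, Finset.card_range, nsmul_eq_mul] at h1
  push_cast at h1
  linarith

theorem E_low {n : ℕ} (hn : 1 ≤ n) {b : ℤ → ℝ} (hb : Bdd b) (h0 : ∀ s, 0 ≤ b s) {η : ℝ} (hη : 0 < η)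
    (h : ∀ d : ℤ, η ≤ ∑ e ∈ Finset.Icc 1 n, b (d * e)) : η / (2 * n ^ 2) ≤ E b := by
  refine E_ge hb ?_
  filter_upwards [eventually_ge_atTop n] with K hK
  have hD1 : 1 ≤ K / n := (Nat.one_le_div_iff (by omega)).2 hK
  have h1 : ∀ e ∈ Finset.Icc 1 n, ∑ d ∈ Finset.Icc 1 (K / n), b ((d : ℕ) * (e : ℕ)) ≤ ∑ i ∈ Finset.range (K + 1), b i := by
    intro e he
    rw [Finset.mem_Icc] at he
    have h2 : Set.InjOn (fun d : ℕ => d * e) (Finset.Icc 1 (K / n) : Finset ℕ) := fun x _ y _ hxy =>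
      Nat.eq_of_mul_eq_mul_right (by omega) hxy
    have h3 := Finset.sum_image (f := fun i : ℕ => b i) h2
    push_cast at h3
    rw [← h3]
    refine Finset.sum_le_sum_of_subset_of_nonneg ?_ fun i _ _ => h0 _
    intro x hx
    obtain ⟨d, hd, rfl⟩ := Finset.mem_image.1 hx
    rw [Finset.mem_Icc] at hd
    rw [Finset.mem_range, Nat.lt_succ_iff]
    calc d * e ≤ (K / n) * n := Nat.mul_le_mul hd.2 he.2
      _ ≤ K := Nat.div_mul_le_self _ _
  have h4 := Finset.sum_le_sum h1
  rw [Finset.sum_comm] at h4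
  have h5 : ∑ d ∈ Finset.Icc 1 (K / n), η ≤ ∑ d ∈ Finset.Icc 1 (K / n), ∑ e ∈ Finset.Icc 1 n, b ((d : ℕ) * (e : ℕ)) :=
    Finset.sum_le_sum fun d _ => h d
  have h6 := h5.trans h4
  simp only [Finset.sum_const, Nat.card_Icc, nsmul_eq_mul, Nat.add_sub_cancel] at h6
  have h7 : (K + 1 : ℝ) ≤ 2 * n * (K / n : ℕ) := by
    have : K + 1 ≤ 2 * n * (K / n) := by
      have h8 := Nat.div_add_mod K n
      have h9 := Nat.mod_lt K (show n > 0 by omega)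
      have : n * 1 ≤ n * (K / n) := Nat.mul_le_mul_left _ hD1
      have : 2 * n * (K / n) = n * (K / n) + n * (K / n) := by ring
      omega
    exact_mod_cast this
  have hn' : (0 : ℝ) < n := by exact_mod_cast hn
  rw [le_div_iff₀ (by positivity), div_mul_eq_mul_div, div_le_iff₀ (by positivity)]
  calc η * (K + 1 : ℝ) ≤ η * (2 * n * (K / n : ℕ)) := by gcongr
    _ = 2 * n * ((K / n : ℕ) * η) := by ring
    _ ≤ 2 * n * (n * ∑ i ∈ Finset.range (K + 1), b i) := by gcongr
    _ = _ := by ring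

theorem E_ev {a b : ℤ → ℝ} (ha : Bdd a) (hb : Bdd b) {k0 : ℤ} (h : ∀ k, k0 ≤ k → a k ≤ b k) : E a ≤ E b := by
  rw [← sub_nonneg, ← E.sub hb ha, ← E_shift (hb.sub ha) k0]
  refine E_ge ((hb.sub ha).comp _) (Eventually.of_forall fun n => ?_)
  refine div_nonneg (Finset.sum_nonneg fun i _ => sub_nonneg.2 (h _ (by omega))) (by positivity)

theorem card_avg (Λ : Set ℤ) (N : ℕ) :
    (Nat.card ↥(Λ ∩ Set.Icc (-(N : ℤ)) (N : ℤ)) : ℝ) = ∑ i ∈ Finset.range (2 * N + 1), ind (-(N : ℤ) + i ∈ Λ) := by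
  classical
  have h1 : Λ ∩ Set.Icc (-(N : ℤ)) (N : ℤ) =
      (((Finset.range (2 * N + 1)).filter fun i : ℕ => -(N : ℤ) + i ∈ Λ).image fun i : ℕ => -(N : ℤ) + i : Finset ℤ) := by
    ext x
    simp only [Set.mem_inter_iff, Set.mem_Icc, Finset.coe_image, Set.mem_image, Finset.coe_filter, Finset.mem_range,
      Set.mem_ofPred_eq]
    constructor
    · rintro ⟨h1, h2, h3⟩
      have : -(N : ℤ) + ((x + N).toNat : ℤ) = x := by omega
      exact ⟨(x + N).toNat, ⟨by omega, by rwa [this]⟩, this⟩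
    · rintro ⟨i, ⟨h1, h2⟩, rfl⟩
      exact ⟨h2, by omega, by omega⟩
  rw [h1, Nat.card_eq_card_toFinset, Finset.toFinset_coe, Finset.card_image_of_injective _ (fun a b h => by simpa using h)]
  simp [ind]

theorem exists_mean (Λ : Set ℤ) (hΛ : 0 < Filter.limsup
    (fun N : ℕ => (Nat.card ↥(Λ ∩ Set.Icc (-(N : ℤ)) (N : ℤ)) : ℝ) / (2 * N + 1)) Filter.atTop) :
    ∃ μ : Mean ℤ, (∀ t f, Bdd f → μ (fun x => f (x + t)) = μ f) ∧ 0 < μ fun x => ind (x ∈ Λ) := by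
  set u := (fun N : ℕ => (Nat.card ↥(Λ ∩ Set.Icc (-(N : ℤ)) (N : ℤ)) : ℝ) / (2 * N + 1)) with hu
  obtain ⟨ρ, h0, hρ⟩ := exists_between hΛ
  have hu0 : ∀ n, 0 ≤ u n := fun n => by positivity
  have hf : ∃ᶠ n in atTop, ρ < u n := frequently_lt_of_lt_limsup
    (isCoboundedUnder_le_of_le atTop (x := 0) hu0) hρ
  have hne : (atTop ⊓ 𝓟 {n : ℕ | ρ < u n}).NeBot := frequently_mem_iff_neBot.1 hf
  let U : Ultrafilter ℕ := Ultrafilter.of (atTop ⊓ 𝓟 {n : ℕ | ρ < u n})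
  have hU : (U : Filter ℕ) ≤ atTop ⊓ 𝓟 {n : ℕ | ρ < u n} := Ultrafilter.of_le _
  have hw : Tendsto (fun n : ℕ => 2 * n) U atTop :=
    (tendsto_atTop_mono (fun n => by simp only [id]; omega) tendsto_id : Tendsto (fun n : ℕ => 2 * n) atTop atTop).mono_left
      (hU.trans inf_le_left)
  refine ⟨ultMean U (fun n => 2 * n) (fun n i => -(n : ℤ) + i), fun t f hb => ultMean_shift U _ hw _ hb t, ?_⟩
  refine h0.trans_le (ge_of_tendsto (ultMean_tendsto U _ _ (ind_bdd _)) ?_)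
  have : ∀ᶠ n in (U : Filter ℕ), ρ < u n := (hU.trans inf_le_right) (mem_principal_self _)
  filter_upwards [this] with n hn
  simp only [hu, card_avg] at hn
  simp only [avg]
  push_cast
  exact hn.le

/-- The main argument. -/
theorem main (ℓ : ℕ) (S : Set ℤ)
    (c : ℕ → ℤ) (N : ℕ → ℕ) (hN : Tendsto N atTop atTop)
    (hS : ∀ m : ℕ, 1 ≤ m → ∀ n : ℤ, 1 ≤ n → n ≤ (N m : ℤ) → c m + (m : ℤ) * n ∈ S)
    (Λ : Set ℤ) (hΛ : 0 < Filter.limsup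
    (fun N : ℕ => (Nat.card ↥(Λ ∩ Set.Icc (-(N : ℤ)) (N : ℤ)) : ℝ) / (2 * N + 1)) Filter.atTop) :
    ∃ r : ℤ, ∃ s ∈ S, s ≠ 0 ∧ ∀ j : ℕ, j ≤ ℓ → r + (j : ℤ) * s ∈ Λ := by
  by_contra! hno
  obtain ⟨μ, inv, hδ⟩ := exists_mean Λ hΛ
  set δ := μ fun x => ind (x ∈ Λ) with hδd
  obtain ⟨n0, hn0⟩ := dhj_fin ℓ (δ / 2) (half_pos hδ)
  have hMD := hn0 (Fin (n0 + 1)) (by simp)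
  set b : ℤ → ℝ := fun s => μ (apx ℓ Λ s) with hbd
  have b0 : ∀ s, 0 ≤ b s := fun s => μ.nonneg (apx_bdd _ _ _) (apx_nn _ _ _)
  have b1 : ∀ s, b s ≤ 1 := fun s => μ.le_of (apx_bdd _ _ _) (apx_le _ _ _)
  have bb : Bdd b := Bdd.of1 fun s => abs_le.2 ⟨by linarith [b0 s], b1 s⟩
  have bz : ∀ s ∈ S, b s ≤ ind (s = 0) := by
    intro s hs
    by_cases h : s = 0
    · rw [ind_t h]; exact b1 s
    · refine le_of_eq_of_le ?_ (ind_nn _)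
      have : apx ℓ Λ s = fun _ => 0 := by
        funext x
        obtain ⟨j, hj, hx⟩ := hno x s hs h
        exact Finset.prod_eq_zero (Finset.mem_univ (⟨j, Nat.lt_succ_iff.2 hj⟩ : Fin (ℓ + 1))) (ind_f hx)
      simp only [hbd, this, μ.const]
  obtain ⟨c0, hc0, hE⟩ : ∃ c0 : ℝ, 0 < c0 ∧ c0 ≤ E b := by
    refine ⟨δ / 2 / (ℓ * (n0 + 1 : ℕ) + 1 : ℝ) / (2 * ((n0 + 1 : ℕ) : ℝ) ^ 2), by positivity, ?_⟩
    refine E_low (by omega) bb b0 (by positivity) fun d => ?_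
    rw [div_le_iff₀ (by positivity), mul_comm]
    exact dil hδ hMD Λ μ inv le_rfl d
  obtain ⟨X, hX⟩ := corr ℓ Unit (c0 / 2) (half_pos hc0)
  set Q : ℤ := 2 * (X.factorial : ℤ) with hQd
  have hQ2 : 2 ≤ Q := by have := Nat.factorial_pos X; omega
  have hDv : Dv X Q := ⟨hQ2, fun t h1 h2 => Dvd.dvd.mul_left (by
    obtain ⟨t', rfl⟩ := Int.eq_ofNat_of_zero_le (show 0 ≤ t by omega)
    exact_mod_cast Nat.dvd_factorial (by omega) (by omega)) 2⟩
  let sys : Sys ℤ ℤ := ⟨fun g x => x + g, fun x => by simp, fun a b x => by ring, μ, fun g f hf => inv g f hf⟩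
  let c' : ℤ → ℤ := fun k => c (1 + Q * k).toNat
  have hcor := hX Q hDv ℤ ℤ sys (fun j => (j : ℤ)) (fun _ _ => 0) (fun _ _ x => ind (x ∈ Λ))
    (fun _ _ x => abs_le.2 ⟨by linarith [ind_nn (x ∈ Λ)], ind_le _⟩) c'
  have hXi : ∀ m s, sys.μ (Xi sys (fun j : Fin (ℓ + 1) => (j : ℤ)) (fun _ (_ : Unit) => 0) (fun _ _ x => ind (x ∈ Λ)) m s) = b s := by
    intro m s
    simp only [hbd]
    congr 1
    funext x
    simp [Xi, apx, sys, mul_comm]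
  simp only [hXi, E.const] at hcor
  set g : ℤ → ℝ := fun n => E fun k => b (c' k + (1 + Q * k) * n) with hg
  have hbg : Bdd g := E.bdd (Φ := fun n k => b (c' k + (1 + Q * k) * n)) (bb.comp fun q : ℤ × ℤ => c' q.2 + (1 + Q * q.2) * q.1)
  have g1 : ∀ n, g n ≤ 1 := fun n => E.le_of (bb.comp _) fun k => b1 _
  have hm : ∀ k : ℤ, 1 + Q * k ≠ 0 := by
    intro k hk
    have : Q ∣ 1 := ⟨-k, by linarith⟩
    have := Int.le_of_dvd one_pos this
    omega
  have hgh : ∀ n : ℕ, g ((n : ℤ) + 1) ≤ E fun k => ind (c' k + (1 + Q * k) * ((n : ℤ) + 1) = 0) := by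
    intro n
    obtain ⟨m1, hm1⟩ := eventually_atTop.1 (hN.eventually_ge_atTop (n + 1))
    refine E_ev (bb.comp _) (ind_bdd _) (k0 := m1) fun k hk => bz _ ?_
    have hk0 : 0 ≤ k := by omega
    have h1 : k ≤ Q * k := by nlinarith
    have h2 : (((1 + Q * k).toNat : ℕ) : ℤ) = 1 + Q * k := Int.toNat_of_nonneg (by omega)
    have h3 := hS (1 + Q * k).toNat (by omega) (n + 1) (by omega) (by
      have := hm1 (1 + Q * k).toNat (by omega)
      omega)
    rw [h2] at h3
    exact h3
  have hsum : ∀ M : ℕ, ∑ n ∈ Finset.range M, g ((n : ℤ) + 1) ≤ 1 := by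
    intro M
    refine (Finset.sum_le_sum fun n _ => hgh n).trans ?_
    rw [← E.sum _ fun n _ => ind_bdd _]
    refine E.le_of (Bdd.sum _ fun n _ => ind_bdd _) fun k => ?_
    by_cases hx : ∃ n ∈ Finset.range M, c' k + (1 + Q * k) * ((n : ℤ) + 1) = 0
    · obtain ⟨n, hn, hz⟩ := hx
      rw [Finset.sum_eq_single_of_mem n hn]
      · exact ind_le _
      · intro n' _ hne
        refine ind_f fun hz' => hne ?_
        have : (1 + Q * k) * ((n' : ℤ) + 1) = (1 + Q * k) * ((n : ℤ) + 1) := by linarith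
        have := mul_left_cancel₀ (hm k) this
        omega
    · push Not at hx
      rw [Finset.sum_eq_zero fun n hn => ind_f (hx n hn)]
      exact zero_le_one
  have hEg : -(c0 / 4) ≤ E fun n => - g n := by
    refine E_ge hbg.neg ?_
    obtain ⟨K0, hK0⟩ := exists_nat_ge (8 / c0)
    filter_upwards [eventually_ge_atTop K0] with K hK
    rw [le_div_iff₀ (by positivity), Finset.sum_neg_distrib]
    have h1 : ∑ i ∈ Finset.range (K + 1), g i ≤ 2 := by
      rw [Finset.sum_range_succ']
      have := hsum K
      have := g1 ((0 : ℕ) : ℤ)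
      push_cast at *
      linarith
    have h2 : 8 / c0 ≤ K := hK0.trans (by exact_mod_cast hK)
    rw [div_le_iff₀ hc0] at h2
    nlinarith
  have hneg : (E fun n => - g n) = - E g := by
    have := E.smul (-1) hbg
    simpa using this
  rw [hneg] at hEg
  have := (abs_le.1 hcor).1
  linarith

end SZ

/-- Theorem B of the paper. -/
theorem stmt_0 (ℓ : ℕ) (hℓ : 1 ≤ ℓ) (S : Set ℤ)
    (c : ℕ → ℤ) (N : ℕ → ℕ) (hN : Tendsto N atTop atTop)
    (hS : ∀ m : ℕ, 1 ≤ m → ∀ n : ℤ, 1 ≤ n → n ≤ (N m : ℤ) → c m + (m : ℤ) * n ∈ S)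
    (Λ : Set ℤ) (hΛ : 0 < upperDensity Λ) :
    ∃ r : ℤ, ∃ s ∈ S, s ≠ 0 ∧ ∀ j : ℕ, j ≤ ℓ → r + (j : ℤ) * s ∈ Λ := by
  exact SZ.main ℓ S c N hN hS Λ hΛ
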